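/- arXiv:math/0612047 — 6 statements merged into one kernel-verified Lean document; each statement's English description precedes it below -/
import Mathlib

section
/- Let p ≥ 1 be an integer and let D be a nonnegative linear combination of pure diagrams of codimension p. Then there exists a function E : ℤ × ℤ → ℚ which is a nonnegative linear combination of extremely compressed diagrams of codimension p, such that D is obtained from E by a sequence of consecutive cancellations, and moreover E 0 j = D 0 j and E p j = D p j for all integers j. -/
/-- The alternating-sign Laurent polynomial `S_D(t) = Σ_{i,j} (-1)^i D(i,j) t^j`
associated to a diagram `D : ℤ × ℤ → ℚ`. -/
noncomputable def SPoly (D : ℤ × ℤ → ℚ) : LaurentPolynomial ℚ :=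
  ∑ᶠ q : ℤ × ℤ, LaurentPolynomial.C ((-1 : ℚ) ^ q.1 * D q) * LaurentPolynomial.T q.2

/-- A diagram of codimension `p`. -/
structure IsDiagram (p : ℕ) (D : ℤ × ℤ → ℚ) : Prop where
  finite : (Function.support D).Finite
  zero_outside : ∀ i j : ℤ, i < 0 ∨ (p : ℤ) < i → D (i, j) = 0
  dvd : (1 - LaurentPolynomial.T 1) ^ p ∣ SPoly D

/-- A pure diagram of type `d` of codimension `p`. -/
structure IsPureDiagram (p : ℕ) (d : Fin (p + 1) → ℤ) (D : ℤ × ℤ → ℚ) : Prop where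
  diagram : IsDiagram p D
  strictMono : StrictMono d
  pure : ∀ (k : Fin (p + 1)) (j : ℤ), j ≠ d k → D (((k : ℕ) : ℤ), j) = 0

/-- `D` is a nonnegative linear combination of pure diagrams of codimension `p`
(each with nonnegative entries). -/
def IsNonnegCombPure (p : ℕ) (D : ℤ × ℤ → ℚ) : Prop :=
  ∃ (n : ℕ) (a : Fin n → ℚ) (P : Fin n → (ℤ × ℤ → ℚ)) (t : Fin n → (Fin (p + 1) → ℤ)),
    (∀ k, 0 ≤ a k) ∧ (∀ k, IsPureDiagram p (t k) (P k)) ∧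
    (∀ k q, 0 ≤ P k q) ∧ D = ∑ k, a k • P k

/-- The sequence `(d₀, j+1, j+2, …, j+p-1, dₚ)`. -/
def midType (p : ℕ) (d0 j dp : ℤ) : Fin (p + 1) → ℤ :=
  fun k => if (k : ℕ) = 0 then d0 else if (k : ℕ) = p then dp else j + ((k : ℕ) : ℤ)

/-- An extremely compressed diagram of codimension `p`: a pure diagram of type
`(d₀, j+1, …, j+p-1, c+p)` for some `d₀ ≤ j ≤ c`. -/
def IsECDiagram (p : ℕ) (D : ℤ × ℤ → ℚ) : Prop :=
  ∃ d0 j c : ℤ, d0 ≤ j ∧ j ≤ c ∧ IsPureDiagram p (midType p d0 j (c + (p : ℤ))) D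

/-- `D` is a nonnegative linear combination of extremely compressed diagrams. -/
def IsNonnegCombEC (p : ℕ) (D : ℤ × ℤ → ℚ) : Prop :=
  ∃ (n : ℕ) (a : Fin n → ℚ) (P : Fin n → (ℤ × ℤ → ℚ)),
    (∀ k, 0 ≤ a k) ∧ (∀ k, IsECDiagram p (P k)) ∧ (∀ k q, 0 ≤ P k q) ∧ D = ∑ k, a k • P k

/-- The consecutive-cancellation diagram `C^{k,l}`. -/
def Ccan (k l : ℤ) : ℤ × ℤ → ℚ := fun q => if q = (k, l) ∨ q = (k + 1, l) then 1 else 0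

/-- `D` is obtained from `E` by a sequence of consecutive cancellations. -/
def ObtainedByCancel (E D : ℤ × ℤ → ℚ) : Prop :=
  ∃ b : ℤ × ℤ → ℚ, (Function.support b).Finite ∧ (∀ q, 0 ≤ b q) ∧ (∀ q, 0 ≤ D q) ∧
    ∀ q, D q = E q - ∑ᶠ r : ℤ × ℤ, b r * Ccan r.1 r.2 q

/-- The Laurent polynomial `Σ_j h_j t^j` of a coefficient function `h : ℤ → ℚ`. -/
noncomputable def rowPoly (h : ℤ → ℚ) : LaurentPolynomial ℚ :=
  ∑ᶠ j : ℤ, LaurentPolynomial.C (h j) * LaurentPolynomial.T j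

/-- `r_i = binom(p-1+i, p-1)` for `i ≥ 0`, and `0` for `i < 0`. -/
def rr (p : ℕ) (i : ℤ) : ℚ :=
  if i < 0 then 0 else (Nat.choose (p - 1 + i.toNat) (p - 1) : ℚ)

/-- Coefficients of the normalized `h`-vector of the extremely compressed diagram
of type `(0, j+1, …, j+p-1, c+p)`. -/
def hpi (p c j : ℕ) (i : ℤ) : ℚ :=
  if 0 ≤ i ∧ i ≤ (j : ℤ) then rr p i
  else if (j : ℤ) < i ∧ i ≤ (c : ℤ) then rr p (j : ℤ) / rr p ((c : ℤ) - (j : ℤ)) * rr p ((c : ℤ) - i)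
  else 0

/-- The linear functional `Σ c_x T^x ↦ Σ c_x φ(x)`. -/
noncomputable def LL (φ : ℚ → ℚ) : LaurentPolynomial ℚ →+ ℚ :=
  (Finsupp.liftAddHom (fun x : ℤ => AddMonoidHom.mulRight (φ x))).comp
    (AddMonoidAlgebra.coeffAddEquiv (R := ℚ) (M := ℤ)).toAddMonoidHom

theorem LL_CT (φ : ℚ → ℚ) (c : ℚ) (x : ℤ) :
    LL φ (LaurentPolynomial.C c * LaurentPolynomial.T x) = c * φ x := by
  rw [← LaurentPolynomial.single_eq_C_mul_T]
  simp [LL, -LaurentPolynomial.single_eq_C_mul_T]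

theorem LL_mul (φ : ℚ → ℚ) (f : LaurentPolynomial ℚ) :
    LL φ ((1 - LaurentPolynomial.T 1) * f) = - LL (fwdDiff 1 φ) f := by
  induction f using LaurentPolynomial.induction_on' with
  | add p q hp hq => rw [mul_add, map_add, map_add, hp, hq]; ring
  | C_mul_T n a =>
    have : (1 - LaurentPolynomial.T 1) * (LaurentPolynomial.C a * LaurentPolynomial.T n)
        = LaurentPolynomial.C a * LaurentPolynomial.T n
          - LaurentPolynomial.C a * LaurentPolynomial.T (n + 1) := by
      rw [LaurentPolynomial.T_add]; ring
    rw [this, map_sub, LL_CT, LL_CT, LL_CT]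
    simp [fwdDiff]; ring

theorem LL_pow_mul (p : ℕ) (φ : ℚ → ℚ) (f : LaurentPolynomial ℚ) :
    LL φ ((1 - LaurentPolynomial.T 1) ^ p * f) = (-1) ^ p * LL ((fwdDiff 1)^[p] φ) f := by
  induction p generalizing φ with
  | zero => simp
  | succ p ih =>
    rw [pow_succ', mul_assoc, LL_mul, ih, Function.iterate_succ_apply, pow_succ]; ring

theorem LL_zero (f : LaurentPolynomial ℚ) : LL 0 f = 0 := by
  induction f using LaurentPolynomial.induction_on' with
  | add p q hp hq => rw [map_add, hp, hq]; ring
  | C_mul_T n a => rw [LL_CT]; simp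

theorem LL_smul (c : ℚ) (φ : ℚ → ℚ) (f : LaurentPolynomial ℚ) : LL (c • φ) f = c * LL φ f := by
  induction f using LaurentPolynomial.induction_on' with
  | add p q hp hq => rw [map_add, map_add, hp, hq]; ring
  | C_mul_T n a => rw [LL_CT, LL_CT]; simp; ring

theorem LL_of_dvd (p : ℕ) (f : LaurentPolynomial ℚ) (h : (1 - LaurentPolynomial.T 1) ^ p ∣ f)
    (P : Polynomial ℚ) (hP : P.natDegree < p) : LL P.eval f = 0 := by
  obtain ⟨g, rfl⟩ := h
  rw [LL_pow_mul, Polynomial.fwdDiff_iter_eq_zero_of_degree_lt hP, LL_zero, mul_zero]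

theorem one_sub_T_dvd (n : ℤ) : (1 - LaurentPolynomial.T 1 : LaurentPolynomial ℚ) ∣
    1 - LaurentPolynomial.T n := by
  have key : ∀ n : ℕ, (1 - LaurentPolynomial.T 1 : LaurentPolynomial ℚ) ∣
      1 - LaurentPolynomial.T n := by
    intro n
    have := sub_dvd_pow_sub_pow (1 : LaurentPolynomial ℚ) (LaurentPolynomial.T 1) n
    rwa [one_pow, LaurentPolynomial.T_pow, mul_one] at this
  obtain ⟨m, rfl | rfl⟩ := n.eq_nat_or_neg
  · exact key m
  · have h : (1 - LaurentPolynomial.T (-(m : ℤ)) : LaurentPolynomial ℚ)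
        = (1 - LaurentPolynomial.T m) * (- LaurentPolynomial.T (-(m : ℤ))) := by
      have := LaurentPolynomial.T_add (R := ℚ) m (-(m : ℤ))
      rw [add_neg_cancel, LaurentPolynomial.T_zero] at this
      linear_combination this
    rw [h]
    exact (key m).mul_right _

theorem one_sub_T_dvd_of_LL (f : LaurentPolynomial ℚ) (h : LL 1 f = 0) :
    (1 - LaurentPolynomial.T 1) ∣ f := by
  have : ∀ f : LaurentPolynomial ℚ, (1 - LaurentPolynomial.T 1) ∣
      LaurentPolynomial.C (LL 1 f) - f := by
    intro f
    induction f using LaurentPolynomial.induction_on' with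
    | add p q hp hq =>
      rw [map_add, map_add]
      convert dvd_add hp hq using 1; ring
    | C_mul_T n a =>
      rw [LL_CT]
      convert (one_sub_T_dvd n).mul_left (LaurentPolynomial.C a) using 1
      simp; ring
  have := this f
  rw [h, map_zero, zero_sub] at this
  exact (dvd_neg).1 this

theorem fwdDiff_descPochhammer (m : ℕ) :
    fwdDiff 1 (descPochhammer ℚ (m + 1)).eval = ((m : ℚ) + 1) • (descPochhammer ℚ m).eval := by
  funext y
  have h1 := congrArg (fun P => Polynomial.eval (y + 1) P) (descPochhammer_succ_left ℚ m)
  have h2 := descPochhammer_succ_eval m y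
  simp at h1
  simp [fwdDiff, h1, h2]
  ring

theorem dvd_of_LL (p : ℕ) (f : LaurentPolynomial ℚ)
    (h : ∀ m < p, LL (descPochhammer ℚ m).eval f = 0) :
    (1 - LaurentPolynomial.T 1) ^ p ∣ f := by
  induction p generalizing f with
  | zero => simp
  | succ p ih =>
    have h0 := h 0 (by omega)
    have : (descPochhammer ℚ 0).eval = (1 : ℚ → ℚ) := by funext y; simp
    rw [this] at h0
    obtain ⟨g, rfl⟩ := one_sub_T_dvd_of_LL f h0
    rw [pow_succ']
    refine mul_dvd_mul_left _ (ih g ?_)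
    intro m hm
    have := h (m + 1) (by omega)
    rw [LL_mul, fwdDiff_descPochhammer, LL_smul] at this
    have hm : (m : ℚ) + 1 ≠ 0 := by positivity
    simpa [hm] using this

/-- barycentric weight -/
def wt (A : Finset ℤ) (x : ℤ) : ℚ := ∏ y ∈ A.erase x, ((x : ℚ) - y)⁻¹

theorem wt_ne_zero (A : Finset ℤ) (x : ℤ) : wt A x ≠ 0 := by
  refine Finset.prod_ne_zero_iff.2 fun y hy => inv_ne_zero (sub_ne_zero.2 ?_)
  exact_mod_cast (Finset.ne_of_mem_erase hy).symm

theorem wt_flat (p : ℕ) (A : Finset ℤ) (hA : A.card = p + 1) (P : Polynomial ℚ)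
    (hP : P.natDegree < p) : ∑ x ∈ A, wt A x * P.eval (x : ℚ) = 0 := by
  have h := Lagrange.coeff_eq_sum (s := A) (v := fun x : ℤ => (x : ℚ)) (P := P)
    (by intro a _ b _ h; simpa using h)
    (by rw [hA]; exact lt_of_le_of_lt Polynomial.degree_le_natDegree (by exact_mod_cast (by omega)))
  rw [hA, Nat.add_sub_cancel, Polynomial.coeff_eq_zero_of_natDegree_lt hP] at h
  rw [h]
  refine Finset.sum_congr rfl fun x hx => ?_
  rw [wt, Finset.prod_inv_distrib, div_eq_mul_inv, mul_comm]

theorem flat_unique (p : ℕ) (A : Finset ℤ) (hA : A.card = p + 1) (u : ℤ → ℚ)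
    (h : ∀ P : Polynomial ℚ, P.natDegree < p → ∑ x ∈ A, u x * P.eval (x : ℚ) = 0)
    (x0 : ℤ) (h0 : x0 ∈ A) (hu : u x0 = 0) : ∀ x ∈ A, u x = 0 := by
  intro x hx
  by_cases hxx : x = x0
  · rw [hxx, hu]
  have hc : ((A.erase x0).erase x).card + 1 = p := by
    rw [Finset.card_erase_of_mem (Finset.mem_erase.2 ⟨hxx, hx⟩), Finset.card_erase_of_mem h0]
    have : 0 < (A.erase x0).card := Finset.card_pos.2 ⟨x, Finset.mem_erase.2 ⟨hxx, hx⟩⟩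
    rw [Finset.card_erase_of_mem h0] at this
    omega
  have := h (∏ y ∈ (A.erase x0).erase x, (Polynomial.X - Polynomial.C (y : ℚ))) (by
    rw [Polynomial.natDegree_finsetProd_X_sub_C_eq_card]; omega)
  rw [Finset.sum_eq_single_of_mem x hx] at this
  · rcases mul_eq_zero.1 this with h | h
    · exact h
    · exfalso
      rw [Polynomial.eval_prod, Finset.prod_eq_zero_iff] at h
      obtain ⟨y, hy, h⟩ := h
      simp [sub_eq_zero] at h
      simp [h] at hy
  · intro z hz hzx
    by_cases hz0 : z = x0
    · rw [hz0, hu, zero_mul]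
    · rw [Polynomial.eval_prod, Finset.prod_eq_zero (i := z), mul_zero]
      · simp [hz, hzx, hz0]
      · simp

/-- rank of `x` in `A` -/
def rk (A : Finset ℤ) (x : ℤ) : ℕ := (A.filter (· < x)).card

theorem rk_mono (A : Finset ℤ) {x y : ℤ} (h : x ≤ y) : rk A x ≤ rk A y :=
  Finset.card_le_card fun z hz => by
    simp only [Finset.mem_filter] at hz ⊢; exact ⟨hz.1, by omega⟩

theorem rk_lt (A : Finset ℤ) {x y : ℤ} (hx : x ∈ A) (h : x < y) : rk A x < rk A y := by
  refine Finset.card_lt_card (Finset.ssubset_iff_of_subset ?_ |>.2 ⟨x, ?_, ?_⟩)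
  · intro z hz
    simp only [Finset.mem_filter] at hz ⊢; exact ⟨hz.1, by omega⟩
  · simp [hx, h]
  · simp

theorem rk_lt_card (A : Finset ℤ) {x : ℤ} (hx : x ∈ A) : rk A x < A.card := by
  refine Finset.card_lt_card (Finset.filter_ssubset.2 ⟨x, hx, by simp⟩)

theorem rk_inj (A : Finset ℤ) {x y : ℤ} (hx : x ∈ A) (hy : y ∈ A) (h : rk A x = rk A y) :
    x = y := by
  rcases lt_trichotomy x y with h' | h' | h'
  · have := rk_lt A hx h'; omega
  · exact h'
  · have := rk_lt A hy h'; omega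

theorem exists_rk (A : Finset ℤ) (k : ℕ) (hk : k < A.card) : ∃ x ∈ A, rk A x = k := by
  have := Finset.surjOn_of_injOn_of_card_le (s := A) (t := Finset.range A.card) (rk A)
    (fun x hx => by simpa using rk_lt_card A hx) (fun x hx y hy h => rk_inj A hx hy h) (by simp)
  obtain ⟨x, hx, h⟩ := this (by simpa using hk : k ∈ (Finset.range A.card : Set ℕ))
  exact ⟨x, hx, h⟩

theorem rk_erase (B : Finset ℤ) {c : ℤ} (hc : c ∈ B) (x : ℤ) :
    rk (B.erase c) x + (if c < x then 1 else 0) = rk B x := by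
  unfold rk
  rw [Finset.filter_erase]
  split_ifs with h
  · exact Finset.card_erase_add_one (by simp [hc, h])
  · rw [Finset.erase_eq_of_notMem (by simp [h])]; rfl

/-- The pure diagram attached to a set of degrees. -/
def pd (A : Finset ℤ) : ℤ × ℤ → ℚ :=
  fun q => if q.2 ∈ A ∧ q.1 = rk A q.2 then |wt A q.2| else 0

theorem pd_nonneg (A : Finset ℤ) (q : ℤ × ℤ) : 0 ≤ pd A q := by
  unfold pd; split_ifs <;> positivity

theorem wt_sign (p : ℕ) (A : Finset ℤ) (hA : A.card = p + 1) {x : ℤ} (hx : x ∈ A) :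
    (-1 : ℚ) ^ (rk A x : ℤ) * |wt A x| = (-1) ^ p * wt A x := by
  have h1 : wt A x = (∏ y ∈ A.erase x, if y < x then (1 : ℚ) else -1) * |wt A x| := by
    unfold wt
    rw [Finset.abs_prod, ← Finset.prod_mul_distrib]
    refine Finset.prod_congr rfl fun y hy => ?_
    split_ifs with h
    · have : (0 : ℚ) < x - y := by rw [sub_pos]; exact_mod_cast h
      rw [one_mul, abs_of_pos (inv_pos.2 this)]
    · have : (x : ℚ) - y < 0 := by
        rw [sub_neg]; exact_mod_cast lt_of_le_of_ne (not_lt.1 h) (Finset.ne_of_mem_erase hy).symm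
      rw [abs_of_neg (inv_lt_zero.2 this)]; ring
  rw [Finset.prod_ite, Finset.prod_const_one, one_mul, Finset.prod_const] at h1
  have h2 := Finset.card_filter_add_card_filter_not (s := A.erase x) (fun y => y < x)
  have h3 : rk (A.erase x) x = rk A x := by have := rk_erase A hx x; simpa using this
  rw [Finset.card_erase_of_mem hx, hA, Nat.add_sub_cancel] at h2
  change rk (A.erase x) x + _ = p at h2
  rw [h3] at h2
  set m := (Finset.filter (fun y => ¬ y < x) (A.erase x)).card
  rw [zpow_natCast]
  conv_rhs => rw [h1, ← h2, pow_add]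
  have : ((-1 : ℚ) ^ m) * (-1) ^ m = 1 := by rw [← mul_pow]; simp
  linear_combination (-(-1 : ℚ) ^ (rk A x) * |wt A x|) * this

theorem SPoly_eq (A : Finset ℤ) (D : ℤ × ℤ → ℚ)
    (h : ∀ q : ℤ × ℤ, D q ≠ 0 → q.2 ∈ A ∧ q.1 = rk A q.2) :
    SPoly D = ∑ x ∈ A, LaurentPolynomial.C ((-1 : ℚ) ^ (rk A x : ℤ) * D (rk A x, x)) *
      LaurentPolynomial.T x := by
  unfold SPoly
  rw [finsum_eq_sum_of_support_subset (s := A.image fun x => ((rk A x : ℤ), x))]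
  · rw [Finset.sum_image]
    intro x _ y _ h
    exact (Prod.mk.inj h).2
  · intro q hq
    have : D q ≠ 0 := by
      intro h0; simp [h0] at hq
    obtain ⟨h1, h2⟩ := h q this
    simp only [Finset.coe_image, Set.mem_image]
    exact ⟨q.2, h1, Prod.ext h2.symm rfl⟩

theorem LL_sum (A : Finset ℤ) (u : ℤ → ℚ) (φ : ℚ → ℚ) :
    LL φ (∑ x ∈ A, LaurentPolynomial.C (u x) * LaurentPolynomial.T x) = ∑ x ∈ A, u x * φ x := by
  rw [map_sum]
  exact Finset.sum_congr rfl fun x _ => LL_CT _ _ _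

theorem pd_supp (A : Finset ℤ) (q : ℤ × ℤ) (h : pd A q ≠ 0) : q.2 ∈ A ∧ q.1 = rk A q.2 := by
  by_contra h'
  simp [pd, h'] at h

theorem finite_supp (A : Finset ℤ) (D : ℤ × ℤ → ℚ)
    (h : ∀ q : ℤ × ℤ, D q ≠ 0 → q.2 ∈ A ∧ q.1 = rk A q.2) : (Function.support D).Finite := by
  refine Set.Finite.subset (A.image fun x => ((rk A x : ℤ), x)).finite_toSet ?_
  intro q hq
  obtain ⟨h1, h2⟩ := h q hq
  simp only [Finset.coe_image, Set.mem_image]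
  exact ⟨q.2, h1, Prod.ext h2.symm rfl⟩

theorem pd_isDiagram (p : ℕ) (A : Finset ℤ) (hA : A.card = p + 1) : IsDiagram p (pd A) where
  finite := finite_supp A _ (pd_supp A)
  zero_outside := by
    intro i j hij
    by_contra h
    obtain ⟨h1, h2⟩ := pd_supp A _ h
    have := rk_lt_card A h1
    simp at h2 this
    omega
  dvd := by
    rw [SPoly_eq A _ (pd_supp A)]
    refine dvd_of_LL p _ fun m hm => ?_
    rw [LL_sum]
    have := wt_flat p A hA (descPochhammer ℚ m) (by rw [descPochhammer_natDegree]; exact hm)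
    rw [← mul_zero ((-1 : ℚ) ^ p), ← this, Finset.mul_sum]
    refine Finset.sum_congr rfl fun x hx => ?_
    rw [← mul_assoc, ← wt_sign p A hA hx]
    simp [pd, hx]

theorem pure_eq (p : ℕ) (d : Fin (p + 1) → ℤ) (D : ℤ × ℤ → ℚ) (h : IsPureDiagram p d D)
    (hD : ∀ q, 0 ≤ D q) : ∃ (A : Finset ℤ) (c : ℚ), A.card = p + 1 ∧ 0 ≤ c ∧ D = c • pd A := by
  let A : Finset ℤ := Finset.univ.image d
  have hA : A.card = p + 1 := by
    rw [Finset.card_image_of_injective _ h.strictMono.injective]; simp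
  have hrk : ∀ k, rk A (d k) = k := by
    intro k
    have : A.filter (· < d k) = (Finset.Iio k).image d := by
      ext y
      simp only [A, Finset.mem_filter, Finset.mem_image, Finset.mem_univ, true_and, Finset.mem_Iio]
      constructor
      · rintro ⟨⟨l, rfl⟩, hl⟩
        exact ⟨l, h.strictMono.lt_iff_lt.1 hl, rfl⟩
      · rintro ⟨l, hl, rfl⟩
        exact ⟨⟨l, rfl⟩, h.strictMono hl⟩
    rw [rk, this, Finset.card_image_of_injective _ h.strictMono.injective]
    simp
  have hsupp : ∀ q : ℤ × ℤ, D q ≠ 0 → q.2 ∈ A ∧ q.1 = rk A q.2 := by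
    rintro ⟨i, j⟩ hq
    have hi : ¬ (i < 0 ∨ (p : ℤ) < i) := fun hi => hq (h.diagram.zero_outside i j hi)
    obtain ⟨k, hk⟩ : ∃ k : Fin (p + 1), ((k : ℕ) : ℤ) = i :=
      ⟨⟨i.toNat, by omega⟩, by simp; omega⟩
    subst hk
    have hj : j = d k := by
      by_contra hj
      exact hq (h.pure k j hj)
    subst hj
    exact ⟨Finset.mem_image_of_mem _ (Finset.mem_univ _), by simp [hrk]⟩
  have hdvd := h.diagram.dvd
  rw [SPoly_eq A D hsupp] at hdvd
  obtain ⟨x0, hx0⟩ : A.Nonempty := Finset.card_pos.1 (by omega)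
  have hw := abs_pos.2 (wt_ne_zero A x0)
  let c : ℚ := D (rk A x0, x0) / |wt A x0|
  have hu := flat_unique p A hA
    (fun x => (-1 : ℚ) ^ (rk A x : ℤ) * (D (rk A x, x) - c * |wt A x|)) (by
      intro P hP
      have h1 := LL_of_dvd p _ hdvd P hP
      rw [LL_sum] at h1
      have h2 := wt_flat p A hA P hP
      have h3 : ∑ x ∈ A, ((-1 : ℚ) ^ (rk A x : ℤ) * |wt A x|) * P.eval (x : ℚ) = 0 := by
        rw [← mul_zero ((-1 : ℚ) ^ p), ← h2, Finset.mul_sum]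
        refine Finset.sum_congr rfl fun x hx => ?_
        rw [wt_sign p A hA hx, mul_assoc]
      have h4 := congrArg₂ (fun u v : ℚ => u - c * v) h1 h3
      simp only [mul_zero, sub_zero] at h4
      rw [← h4, Finset.mul_sum, ← Finset.sum_sub_distrib]
      refine Finset.sum_congr rfl fun x hx => ?_
      ring) x0 hx0 (by simp only [c]; field_simp; simp)
  refine ⟨A, c, hA, div_nonneg (hD _) hw.le, ?_⟩
  funext q
  by_cases hq : q.2 ∈ A ∧ q.1 = rk A q.2
  · have := hu q.2 hq.1
    rw [← hq.2] at this
    rcases mul_eq_zero.1 this with h' | h'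
    · exact absurd h' (zpow_ne_zero _ (by norm_num))
    · simp [pd, hq.1, ← hq.2]; linarith
  · have h1 : D q = 0 := by
      by_contra h1; exact hq (hsupp q h1)
    simp [pd, hq, h1]

theorem pd_EC (p : ℕ) (hp : 1 ≤ p) (A : Finset ℤ) (hA : A.card = p + 1) (d0 dp j : ℤ)
    (h0 : d0 ∈ A) (hr0 : rk A d0 = 0) (h1 : dp ∈ A) (hrp : rk A dp = p)
    (hj : d0 ≤ j) (hj' : j + p ≤ dp)
    (hmid : ∀ x ∈ A, 1 ≤ rk A x → rk A x < p → x = j + rk A x) : IsECDiagram p (pd A) := by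
  refine ⟨d0, j, dp - p, hj, by omega, pd_isDiagram p A hA, ?_, ?_⟩
  · intro k l hkl
    have := l.2
    have hkl : (k : ℕ) < l := hkl
    simp only [midType]
    split_ifs <;> omega
  · intro k x hx
    by_contra h
    obtain ⟨h2, h3⟩ := pd_supp A _ h
    simp only [Nat.cast_inj] at h2 h3
    apply hx
    have := k.2
    simp only [midType]
    split_ifs with hk hk
    · exact rk_inj A h2 h0 (by omega)
    · rw [sub_add_cancel]; exact rk_inj A h2 h1 (by omega)
    · rw [h3]; exact hmid x h2 (by omega) (by omega)

theorem wt_erase (B : Finset ℤ) {c x : ℤ} (hc : c ∈ B) (hxc : x ≠ c) :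
    wt (B.erase c) x = ((x : ℚ) - c) * wt B x := by
  have : (x : ℚ) - c ≠ 0 := sub_ne_zero.2 (by exact_mod_cast hxc)
  unfold wt
  rw [Finset.erase_right_comm, ← Finset.mul_prod_erase (B.erase x) _
    (Finset.mem_erase.2 ⟨hxc.symm, hc⟩), ← mul_assoc, mul_inv_cancel₀ this, one_mul]

theorem pd_erase (B : Finset ℤ) {c x : ℤ} (hc : c ∈ B) (hx : x ∈ B) (i : ℤ) :
    pd (B.erase c) (i, x) =
      if i + (if c < x then 1 else 0) = rk B x then |(x : ℚ) - c| * |wt B x| else 0 := by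
  by_cases hxc : x = c
  · subst hxc; simp [pd]
  · have h := rk_erase B hc x
    have hh : (i = rk (B.erase c) x) ↔ (i + (if c < x then 1 else 0) = rk B x) := by
      rw [← h]; split_ifs <;> push_cast <;> constructor <;> intro _ <;> omega
    simp only [pd, Finset.mem_erase, ne_eq, hxc, hx, not_false_eq_true, true_and, hh,
      wt_erase B hc hxc, abs_mul]

/-- cancellation coefficients -/
def bb (B : Finset ℤ) (a b : ℤ) (s t : ℚ) : ℤ × ℤ → ℚ := fun q =>
  if q.2 ∈ B ∧ a < q.2 ∧ q.2 < b ∧ q.1 + 1 = rk B q.2 then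
    min (s * ((q.2 : ℚ) - a)) (t * (b - (q.2 : ℚ))) * |wt B q.2| else 0

theorem step_eq (B : Finset ℤ) {a b e : ℤ} (ha : a ∈ B) (hb : b ∈ B) (he : e ∈ B)
    (hae : a < e) (heb : e < b) (s t : ℚ) (hst : s + t = 1) (hst' : s * a + t * b = e)
    (q : ℤ × ℤ) :
    pd (B.erase e) q = s * pd (B.erase a) q + t * pd (B.erase b) q
      - bb B a b s t q - bb B a b s t (q.1 - 1, q.2) := by
  obtain ⟨i, x⟩ := q
  by_cases hx : x ∈ B
  swap
  · simp [pd, bb, hx]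
  rw [pd_erase B ha hx, pd_erase B hb hx, pd_erase B he hx]
  simp only [bb, hx, true_and, sub_add_cancel]
  generalize |wt B x| = W
  generalize rk B x = r
  have hs : s = 1 - t := by linarith
  subst hs
  have key : (x : ℚ) - e = (1 - t) * (x - a) - t * (b - x) := by rw [← hst']; ring
  rcases le_or_gt x a with h1 | h1
  · have h1' : (x : ℚ) ≤ a := by exact_mod_cast h1
    have h2' : (x : ℚ) ≤ e := by exact_mod_cast (by omega)
    have h3' : (x : ℚ) ≤ b := by exact_mod_cast (by omega)
    rw [abs_of_nonpos (sub_nonpos.2 h1'), abs_of_nonpos (sub_nonpos.2 h2'),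
      abs_of_nonpos (sub_nonpos.2 h3'), key]
    rw [if_neg (by omega : ¬ e < x), if_neg (by omega : ¬ a < x), if_neg (by omega : ¬ b < x)]
    simp only [not_lt.2 h1, false_and, if_false]
    split_ifs <;> ring
  rcases le_or_gt b x with h2 | h2
  · have h1' : (a : ℚ) ≤ x := by exact_mod_cast (by omega)
    have h2' : (e : ℚ) ≤ x := by exact_mod_cast (by omega)
    have h3' : (b : ℚ) ≤ x := by exact_mod_cast h2
    rw [abs_of_nonneg (sub_nonneg.2 h1'), abs_of_nonneg (sub_nonneg.2 h2'),
      abs_of_nonneg (sub_nonneg.2 h3'), key]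
    simp only [not_lt.2 h2, false_and, and_false, if_false]
    rw [if_pos (by omega : e < x), if_pos (by omega : a < x)]
    by_cases hbx : b < x
    · rw [if_pos hbx]; split_ifs <;> ring
    · have : b = x := by omega
      subst this
      simp only [sub_self]; split_ifs <;> ring
  have h1' : (a : ℚ) ≤ x := by exact_mod_cast h1.le
  have h3' : (x : ℚ) ≤ b := by exact_mod_cast h2.le
  rw [abs_of_nonneg (sub_nonneg.2 h1'), abs_of_nonpos (sub_nonpos.2 h3')]
  simp only [h1, h2, true_and, if_true, if_neg (not_lt.2 h2.le), add_zero]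
  rcases le_or_gt x e with h3 | h3
  · have h2' : (x : ℚ) ≤ e := by exact_mod_cast h3
    rw [abs_of_nonpos (sub_nonpos.2 h2'), min_eq_left (by linarith), key,
      if_neg (not_lt.2 h3), add_zero]
    split_ifs <;> first | omega | ring
  · have h2' : (e : ℚ) ≤ x := by exact_mod_cast h3.le
    rw [abs_of_nonneg (sub_nonneg.2 h2'), min_eq_right (by linarith), key, if_pos h3]
    split_ifs <;> first | omega | ring

theorem bb_nonneg (B : Finset ℤ) (a b : ℤ) (s t : ℚ) (hs : 0 ≤ s) (ht : 0 ≤ t) (q : ℤ × ℤ) :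
    0 ≤ bb B a b s t q := by
  unfold bb
  split_ifs with h
  · have h1 : (a : ℚ) < q.2 := by exact_mod_cast h.2.1
    have h2 : (q.2 : ℚ) < b := by exact_mod_cast h.2.2.1
    exact mul_nonneg (le_min (mul_nonneg hs (by linarith)) (mul_nonneg ht (by linarith)))
      (abs_nonneg _)
  · exact le_rfl

theorem bb_supp (B : Finset ℤ) (a b : ℤ) (s t : ℚ) (q : ℤ × ℤ) (h : bb B a b s t q ≠ 0) :
    q.2 ∈ B ∧ a < q.2 ∧ q.2 < b ∧ q.1 + 1 = rk B q.2 := by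
  by_contra h'
  simp [bb, h'] at h

theorem bb_finite (B : Finset ℤ) (a b : ℤ) (s t : ℚ) :
    (Function.support (bb B a b s t)).Finite := by
  refine Set.Finite.subset (B.image fun x => ((rk B x : ℤ) - 1, x)).finite_toSet ?_
  intro q hq
  obtain ⟨h1, _, _, h2⟩ := bb_supp B a b s t q hq
  simp only [Finset.coe_image, Set.mem_image]
  exact ⟨q.2, h1, Prod.ext (by simp only; omega) rfl⟩

theorem EC_add (p : ℕ) (D D' : ℤ × ℤ → ℚ) (h : IsNonnegCombEC p D) (h' : IsNonnegCombEC p D') :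
    IsNonnegCombEC p (D + D') := by
  obtain ⟨n, a, P, h1, h2, h3, rfl⟩ := h
  obtain ⟨n', a', P', h1', h2', h3', rfl⟩ := h'
  refine ⟨n + n', Fin.append a a', Fin.append P P', ?_, ?_, ?_, ?_⟩
  · intro k; refine Fin.addCases (fun i => ?_) (fun i => ?_) k <;> simp [h1, h1']
  · intro k; refine Fin.addCases (fun i => ?_) (fun i => ?_) k <;> simp [h2, h2']
  · intro k; refine Fin.addCases (fun i => ?_) (fun i => ?_) k <;> simp [h3, h3']
  · rw [Fin.sum_univ_add]; simp

theorem EC_smul (p : ℕ) (c : ℚ) (hc : 0 ≤ c) (D : ℤ × ℤ → ℚ) (h : IsNonnegCombEC p D) :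
    IsNonnegCombEC p (c • D) := by
  obtain ⟨n, a, P, h1, h2, h3, rfl⟩ := h
  refine ⟨n, fun k => c * a k, P, fun k => mul_nonneg hc (h1 k), h2, h3, ?_⟩
  rw [Finset.smul_sum]
  exact Finset.sum_congr rfl fun k _ => by rw [smul_smul]

/-- The conclusion of the theorem, in a form closed under nonnegative combinations. -/
def Good (p : ℕ) (D : ℤ × ℤ → ℚ) : Prop :=
  ∃ E b : ℤ × ℤ → ℚ, IsNonnegCombEC p E ∧ (Function.support b).Finite ∧ (∀ q, 0 ≤ b q) ∧
    (∀ q, b q ≠ 0 → 1 ≤ q.1 ∧ q.1 + 1 < p) ∧ ∀ q, D q = E q - b q - b (q.1 - 1, q.2)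

theorem good_cancel (p : ℕ) (D D' b : ℤ × ℤ → ℚ) (h : Good p D') (hf : (Function.support b).Finite)
    (hb : ∀ q, 0 ≤ b q) (hs : ∀ q, b q ≠ 0 → 1 ≤ q.1 ∧ q.1 + 1 < p)
    (hD : ∀ q, D q = D' q - b q - b (q.1 - 1, q.2)) : Good p D := by
  obtain ⟨E, c, h1, h2, h3, h4, h5⟩ := h
  refine ⟨E, fun q => b q + c q, h1, ?_, fun q => add_nonneg (hb q) (h3 q), ?_, ?_⟩
  · exact (hf.union h2).subset (Function.support_add b c)
  · intro q hq
    by_cases hbq : b q = 0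
    · exact h4 q (by simpa [hbq] using hq)
    · exact hs q hbq
  · intro q; rw [hD, h5]; ring

theorem good_add (p : ℕ) (D D' : ℤ × ℤ → ℚ) (h : Good p D) (h' : Good p D') : Good p (D + D') := by
  obtain ⟨E, c, h1, h2, h3, h4, h5⟩ := h
  obtain ⟨E', c', h1', h2', h3', h4', h5'⟩ := h'
  refine ⟨E + E', fun q => c q + c' q, EC_add p _ _ h1 h1', ?_,
    fun q => add_nonneg (h3 q) (h3' q), ?_, ?_⟩
  · exact (h2.union h2').subset (Function.support_add c c')
  · intro q hq
    by_cases hbq : c q = 0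
    · exact h4' q (by simpa [hbq] using hq)
    · exact h4 q hbq
  · intro q; simp only [Pi.add_apply]; rw [h5, h5']; ring

theorem good_smul (p : ℕ) (a : ℚ) (ha : 0 ≤ a) (D : ℤ × ℤ → ℚ) (h : Good p D) :
    Good p (a • D) := by
  obtain ⟨E, c, h1, h2, h3, h4, h5⟩ := h
  refine ⟨a • E, a • c, EC_smul p a ha _ h1, ?_, fun q => mul_nonneg ha (h3 q), ?_, ?_⟩
  · exact h2.subset (Function.support_const_smul_subset a c)
  · intro q hq
    exact h4 q (fun h0 => hq (by simp [h0]))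
  · intro q; simp only [Pi.smul_apply, smul_eq_mul]; rw [h5]; ring

theorem good_zero (p : ℕ) : Good p 0 :=
  ⟨0, 0, ⟨0, Fin.elim0, Fin.elim0, fun k => k.elim0, fun k => k.elim0, fun k => k.elim0, by simp⟩,
    by simp, by simp, by simp, by simp⟩

theorem good_of_EC (p : ℕ) (A : Finset ℤ) (h : IsECDiagram p (pd A)) : Good p (pd A) :=
  ⟨pd A, 0, ⟨1, fun _ => 1, fun _ => pd A, by simp, fun _ => h, fun _ => pd_nonneg A, by simp⟩,
    by simp, by simp, by simp, by simp⟩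

theorem pd_good_aux (p : ℕ) (hp : 2 ≤ p) (n : ℕ) : ∀ (A : Finset ℤ) (a b : ℤ), A.card = p + 1 →
    a ∈ A → rk A a = 1 → b ∈ A → rk A b + 1 = p → (b - a).toNat < n → Good p (pd A) := by
  induction n with
  | zero => intro A a b _ _ _ _ _ h; omega
  | succ n ih =>
    intro A a b hA ha hra hb hrb hn
    by_cases hex : ∃ e, a < e ∧ e < b ∧ e ∉ A
    · obtain ⟨e, hae, heb, he⟩ := hex
      obtain ⟨B, hB⟩ : ∃ B, B = insert e A := ⟨_, rfl⟩
      have heB : e ∈ B := by rw [hB]; exact Finset.mem_insert_self _ _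
      have haB : a ∈ B := by rw [hB]; exact Finset.mem_insert_of_mem ha
      have hbB : b ∈ B := by rw [hB]; exact Finset.mem_insert_of_mem hb
      have hcB : B.card = p + 2 := by rw [hB, Finset.card_insert_of_notMem he, hA]
      have hBe : B.erase e = A := by rw [hB, Finset.erase_insert he]
      have hra' := rk_erase B heB a
      have hrb' := rk_erase B heB b
      rw [hBe, if_neg (by omega), hra] at hra'
      rw [hBe, if_pos heb, hrb] at hrb'
      have g1 : Good p (pd (B.erase a)) := by
        have hc : (B.erase a).card = p + 1 := by rw [Finset.card_erase_of_mem haB, hcB]; rfl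
        obtain ⟨a', ha', hr'⟩ := exists_rk (B.erase a) 1 (by omega)
        have h1 := rk_erase B haB a'
        have h2 := rk_erase B haB b
        rw [if_pos (by omega)] at h2
        have hne : a' ≠ a := Finset.ne_of_mem_erase ha'
        have hlt : a < a' := by
          by_contra hlt
          rw [if_neg hlt] at h1
          exact hne (rk_inj B (Finset.mem_of_mem_erase ha') haB (by omega))
        exact ih (B.erase a) a' b hc ha' hr' (Finset.mem_erase.2 ⟨by omega, hbB⟩) (by omega)
          (by omega)
      have g2 : Good p (pd (B.erase b)) := by
        have hc : (B.erase b).card = p + 1 := by rw [Finset.card_erase_of_mem hbB, hcB]; rfl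
        obtain ⟨b', hb', hr'⟩ := exists_rk (B.erase b) (p - 1) (by omega)
        have h1 := rk_erase B hbB b'
        have h2 := rk_erase B hbB a
        rw [if_neg (by omega)] at h2
        have hne : b' ≠ b := Finset.ne_of_mem_erase hb'
        have hlt : b' < b := by
          by_contra hlt
          rw [if_pos (by omega)] at h1
          exact hne (rk_inj B (Finset.mem_of_mem_erase hb') hbB (by omega))
        exact ih (B.erase b) a b' hc (Finset.mem_erase.2 ⟨by omega, haB⟩) (by omega) hb'
          (by omega) (by omega)
      have hae' : (a : ℚ) < e := by exact_mod_cast hae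
      have heb' : (e : ℚ) < b := by exact_mod_cast heb
      have hba : (0 : ℚ) < b - a := by linarith
      set s : ℚ := (b - e) / (b - a) with hs
      set t : ℚ := (e - a) / (b - a) with ht
      have hs0 : 0 ≤ s := div_nonneg (by linarith) hba.le
      have ht0 : 0 ≤ t := div_nonneg (by linarith) hba.le
      refine good_cancel p _ _ (bb B a b s t)
        (good_add p _ _ (good_smul p s hs0 _ g1) (good_smul p t ht0 _ g2))
        (bb_finite B a b s t) (bb_nonneg B a b s t hs0 ht0) ?_ ?_
      · intro q hq
        obtain ⟨h1, h2, h3, h4⟩ := bb_supp B a b s t q hq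
        have h5 := rk_lt B haB h2
        have h6 := rk_lt B h1 h3
        omega
      · intro q
        have := step_eq B haB hbB heB hae heb s t
          (by rw [hs, ht]; field_simp; ring) (by rw [hs, ht]; field_simp; ring) q
        rw [hBe] at this
        simpa using this
    · push Not at hex
      obtain ⟨d0, hd0, hr0⟩ := exists_rk A 0 (by omega)
      obtain ⟨dp, hdp, hrp⟩ := exists_rk A p (by omega)
      have hcons : ∀ x ∈ A, a ≤ x → x ≤ b → (rk A x : ℤ) = 1 + (x - a) := by
        intro x hx hax hxb
        have : A.filter (· < x) = A.filter (· < a) ∪ Finset.Ico a x := by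
          ext y
          simp only [Finset.mem_union, Finset.mem_filter, Finset.mem_Ico]
          constructor
          · rintro ⟨h1, h2⟩
            by_cases hy : y < a
            · exact Or.inl ⟨h1, hy⟩
            · exact Or.inr ⟨by omega, h2⟩
          · rintro (⟨h1, h2⟩ | ⟨h1, h2⟩)
            · exact ⟨h1, by omega⟩
            · refine ⟨?_, h2⟩
              rcases eq_or_lt_of_le h1 with h | h
              · rw [← h]; exact ha
              · exact hex y h (by omega)
        have hd : Disjoint (A.filter (· < a)) (Finset.Ico a x) := by
          rw [Finset.disjoint_left]
          intro y h1 h2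
          simp only [Finset.mem_filter, Finset.mem_Ico] at h1 h2
          omega
        have hc : rk A x = rk A a + (x - a).toNat := by
          rw [rk, this, Finset.card_union_of_disjoint hd, Int.card_Ico]; rfl
        omega
      have hlt : ∀ x ∈ A, ∀ y ∈ A, rk A x < rk A y → x < y := by
        intro x _ y _ h
        by_contra h'
        have := rk_mono A (not_lt.1 h')
        omega
      have hle : ∀ x ∈ A, ∀ y ∈ A, rk A x ≤ rk A y → x ≤ y := by
        intro x hx y hy h
        by_contra h'
        have := rk_lt A hy (not_le.1 h')
        omega
      have hab := hcons b hb (hle a ha b hb (by omega)) le_rfl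
      have h1 := hlt d0 hd0 a ha (by omega)
      have h2 := hlt b hb dp hdp (by omega)
      refine good_of_EC p A (pd_EC p (by omega) A hA d0 dp (a - 1) hd0 hr0 hdp hrp (by omega)
        (by omega) ?_)
      intro x hx hx1 hx2
      have := hcons x hx (hle a ha x hx (by omega)) (hle x hx b hb (by omega))
      omega

theorem pd_good (p : ℕ) (hp : 1 ≤ p) (A : Finset ℤ) (hA : A.card = p + 1) : Good p (pd A) := by
  rcases Nat.lt_or_ge 1 p with h | h
  · obtain ⟨a, ha, hra⟩ := exists_rk A 1 (by omega)
    obtain ⟨b, hb, hrb⟩ := exists_rk A (p - 1) (by omega)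
    exact pd_good_aux p h _ A a b hA ha hra hb (by omega) (Nat.lt_succ_self _)
  · obtain ⟨d0, hd0, hr0⟩ := exists_rk A 0 (by omega)
    obtain ⟨dp, hdp, hrp⟩ := exists_rk A p (by omega)
    refine good_of_EC p A (pd_EC p hp A hA d0 dp d0 hd0 hr0 hdp hrp le_rfl ?_ ?_)
    · by_contra h'
      have := rk_mono A (by omega : dp ≤ d0)
      omega
    · intro x _ _ _; omega

theorem sum_Ccan (b : ℤ × ℤ → ℚ) (q : ℤ × ℤ) :
    ∑ᶠ r : ℤ × ℤ, b r * Ccan r.1 r.2 q = b q + b (q.1 - 1, q.2) := by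
  obtain ⟨i, j⟩ := q
  rw [finsum_eq_sum_of_support_subset (s := {(i, j), (i - 1, j)})]
  · rw [Finset.sum_pair (by simp; omega)]
    simp [Ccan]
  · intro r hr
    have hr : ¬ (b r * Ccan r.1 r.2 (i, j) = 0) := hr
    obtain ⟨k, l⟩ := r
    simp only [Finset.coe_insert, Finset.coe_singleton, Set.mem_insert_iff, Set.mem_singleton_iff]
    by_contra h
    apply hr
    rw [Ccan, if_neg, mul_zero]
    simp only [Prod.mk.injEq] at h ⊢
    omega

/-- every nonnegative linear combination of pure diagrams of codimension
`p ≥ 1` is obtained, by a sequence of consecutive cancellations, from a nonnegative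
linear combination `E` of extremely compressed diagrams agreeing with `D` in rows `0` and `p`. -/
theorem stmt0 (p : ℕ) (hp : 1 ≤ p) (D : ℤ × ℤ → ℚ) (hD : IsNonnegCombPure p D) :
    ∃ E : ℤ × ℤ → ℚ, IsNonnegCombEC p E ∧ ObtainedByCancel E D ∧
      (∀ j : ℤ, E (0, j) = D (0, j)) ∧ (∀ j : ℤ, E ((p : ℤ), j) = D ((p : ℤ), j)) := by
  have hgood : Good p D := by
    obtain ⟨n, a, P, t, h1, h2, h3, rfl⟩ := hD
    refine Finset.sum_induction _ (Good p) (good_add p) (good_zero p) fun k _ => ?_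
    obtain ⟨A, c, hA, hc, h⟩ := pure_eq p (t k) (P k) (h2 k) (h3 k)
    rw [h]
    exact good_smul p _ (h1 k) _ (good_smul p c hc _ (pd_good p hp A hA))
  have hnonneg : ∀ q, 0 ≤ D q := by
    obtain ⟨n, a, P, t, h1, h2, h3, rfl⟩ := hD
    intro q
    rw [Finset.sum_apply]
    exact Finset.sum_nonneg fun k _ => mul_nonneg (h1 k) (h3 k q)
  obtain ⟨E, b, h1, h2, h3, h4, h5⟩ := hgood
  have hb : ∀ i j : ℤ, (i < 1 ∨ (p : ℤ) ≤ i + 1) → b (i, j) = 0 := by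
    intro i j hij
    by_contra h
    have := h4 _ h
    simp only at this
    omega
  refine ⟨E, h1, ⟨b, h2, h3, hnonneg, fun q => ?_⟩, fun j => ?_, fun j => ?_⟩
  · rw [sum_Ccan, h5]; ring
  · rw [h5, hb _ _ (Or.inl (by omega)), hb _ _ (Or.inl (by simp))]; ring
  · rw [h5, hb _ _ (Or.inr (by omega)), hb _ _ (Or.inr (by simp))]; ring
end

section
/- Let p ≥ 2 and let d = (d_0, j_0+1, j_0+2, ..., j_0+p-1, d_p) be a strictly increasing sequence of integers (so d_0 ≤ j_0 and j_0+p-1 < d_p), and let π be a normalized pure diagram of type d. Then there exist nonnegative rationals a_j (indexed by integers j ≥ d_0, finitely many nonzero), normalized pure diagrams π_j of type (d_0, j+1, j+2, ..., j+p-1, j+p) with nonnegative entries, and nonnegative rationals b_{k,l} (finitely many nonzero), such that π = Σ_j a_j π_j − Σ_{k,l} b_{k,l} C^{k,l}. -/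
open Polynomial in
/-- A linear functional killing monic polynomials of each degree `< p` kills degree `< p`. -/
lemma aux_functional (p : ℕ) (L : ℚ[X] →ₗ[ℚ] ℚ) (W : ℕ → ℚ[X])
    (hW : ∀ m, (W m).Monic) (hd : ∀ m, (W m).natDegree = m)
    (hL : ∀ m < p, L (W m) = 0) : ∀ q : ℚ[X], q.degree < p → L q = 0 := by
  suffices h : ∀ n ≤ p, ∀ q : ℚ[X], q.degree < n → L q = 0 from h p le_rfl
  intro n
  induction n with
  | zero =>
    intro _ q hq
    have : q = 0 := by
      rw [← Polynomial.degree_eq_bot]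
      simpa using hq
    simp [this]
  | succ n ih =>
    intro hn q hq
    have h1 : (q - Polynomial.C (q.coeff n) * W n).degree < n := by
      rw [Polynomial.degree_lt_iff_coeff_zero]
      intro m hm
      rcases hm.eq_or_lt with rfl | hm
      · have : (W n).coeff n = 1 := by
          have := (hW n).coeff_natDegree
          rwa [hd] at this
        simp [this]
      · have h2 : q.coeff m = 0 := Polynomial.coeff_eq_zero_of_degree_lt
          (lt_of_lt_of_le hq (by exact_mod_cast hm))
        have h3 : (W n).coeff m = 0 :=
          Polynomial.coeff_eq_zero_of_natDegree_lt (by rw [hd]; exact hm)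
        simp [h2, h3]
    have h2 := ih (by omega) _ h1
    rw [map_sub, ← Polynomial.smul_eq_C_mul, map_smul, hL n (by omega)] at h2
    simpa using h2

open Polynomial in
lemma aux_toLaurent_dvd (p : ℕ) (G : ℚ[X]) :
    (1 - LaurentPolynomial.T 1 : LaurentPolynomial ℚ) ^ p ∣ Polynomial.toLaurent G ↔
      (Polynomial.X - Polynomial.C 1) ^ p ∣ G := by
  have hT : (1 - LaurentPolynomial.T 1 : LaurentPolynomial ℚ) ^ p =
      Polynomial.toLaurent ((1 - X) ^ p) := by simp
  have hs : (Polynomial.X - Polynomial.C 1 : ℚ[X]) ^ p ∣ G ↔ (1 - X) ^ p ∣ G := by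
    have : (1 - X : ℚ[X]) = - (X - Polynomial.C 1) := by simp
    rw [this, neg_pow]
    rw [IsUnit.mul_left_dvd]
    exact (isUnit_one.neg).pow p
  rw [hs, hT]
  constructor
  · rintro ⟨h, hh⟩
    obtain ⟨n, h', hn⟩ := LaurentPolynomial.exists_T_pow h
    have : Polynomial.toLaurent (G * X ^ n) = Polynomial.toLaurent ((1 - X) ^ p * h') := by
      rw [map_mul, map_mul, hn, hh]
      simp [mul_assoc]
    have := Polynomial.toLaurent_injective this
    have hd : (1 - X : ℚ[X]) ^ p ∣ G * X ^ n := ⟨h', this⟩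
    refine IsCoprime.dvd_of_dvd_mul_right ?_ hd
    exact IsCoprime.pow ⟨1, 1, by ring⟩
  · exact map_dvd _

open Polynomial in
/-- Divisibility by `(1-T)^p` in terms of moments. -/
lemma aux_dvd_iff (p : ℕ) (s : Finset ℤ) (c : ℤ → ℚ) :
    (1 - LaurentPolynomial.T 1) ^ p ∣
      (∑ l ∈ s, LaurentPolynomial.C (c l) * LaurentPolynomial.T l : LaurentPolynomial ℚ) ↔
    ∀ q : ℚ[X], q.degree < p → ∑ l ∈ s, c l * q.eval (l : ℚ) = 0 := by
  obtain ⟨N, hN⟩ : ∃ N : ℤ, ∀ l ∈ s, 0 ≤ l + N := by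
    obtain ⟨M, hM⟩ := s.bddBelow
    exact ⟨-M, fun l hl => by have := hM (Finset.mem_coe.2 hl); omega⟩
  set G : ℚ[X] := ∑ l ∈ s, Polynomial.C (c l) * X ^ (l + N).toNat with hG
  have hGL : Polynomial.toLaurent G = LaurentPolynomial.T N *
      (∑ l ∈ s, LaurentPolynomial.C (c l) * LaurentPolynomial.T l) := by
    rw [hG, map_sum, Finset.mul_sum]
    refine Finset.sum_congr rfl fun l hl => ?_
    rw [Polynomial.toLaurent_C_mul_X_pow, Int.toNat_of_nonneg (hN l hl), LaurentPolynomial.T_add]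
    ring
  rw [← (LaurentPolynomial.isUnit_T (R := ℚ) N).dvd_mul_left, ← hGL, aux_toLaurent_dvd]
  have hder : ∀ m, (derivative^[m] G).eval 1 =
      ∑ l ∈ s, c l * ((descPochhammer ℚ m).comp (X + Polynomial.C (N : ℚ))).eval (l : ℚ) := by
    intro m
    rw [hG, Polynomial.iterate_derivative_sum, Polynomial.eval_finsetSum]
    refine Finset.sum_congr rfl fun l hl => ?_
    have h1 : (l : ℚ) + N = (((l + N).toNat : ℕ) : ℚ) := by
      have := Int.toNat_of_nonneg (hN l hl)
      exact_mod_cast this.symm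
    rw [Polynomial.iterate_derivative_C_mul, Polynomial.iterate_derivative_X_pow_eq_smul]
    simp [h1, descPochhammer_eval_eq_descFactorial]
    ring
  have hdeg : ∀ m, ((descPochhammer ℚ m).comp (X + Polynomial.C (N : ℚ))).natDegree = m := by
    intro m
    rw [Polynomial.natDegree_comp, descPochhammer_natDegree, Polynomial.natDegree_X_add_C, mul_one]
  have hmon : ∀ m, ((descPochhammer ℚ m).comp (X + Polynomial.C (N : ℚ))).Monic := by
    intro m
    exact (monic_descPochhammer ℚ m).comp_X_add_C _
  have hiff : (X - Polynomial.C 1) ^ p ∣ G ↔ ∀ m < p, (derivative^[m] G).eval 1 = 0 := by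
    constructor
    · intro h m hm
      have := Polynomial.pow_sub_dvd_iterate_derivative_of_pow_dvd m h
      have h2 : (X - Polynomial.C 1) ∣ derivative^[m] G :=
        (dvd_pow_self _ (by omega)).trans this
      exact Polynomial.dvd_iff_isRoot.1 h2
    · intro h
      by_cases hG0 : G = 0
      · simp [hG0]
      rcases p with _ | p
      · simp
      have := (Polynomial.lt_rootMultiplicity_iff_isRoot_iterate_derivative (t := 1) (n := p) hG0).2
        (fun m hm => h m (by omega))
      exact (Polynomial.le_rootMultiplicity_iff hG0).1 this
  rw [hiff]
  constructor
  · intro h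
    let L : ℚ[X] →ₗ[ℚ] ℚ := ∑ l ∈ s, c l • Polynomial.leval (l : ℚ)
    have hL : ∀ q, L q = ∑ l ∈ s, c l * q.eval (l : ℚ) := by
      intro q; simp [L, Polynomial.leval]
    intro q hq
    rw [← hL]
    refine aux_functional p L _ hmon hdeg (fun m hm => ?_) q hq
    rw [hL, ← hder, h m hm]
  · intro h m hm
    rw [hder]
    apply h
    refine lt_of_le_of_lt Polynomial.degree_le_natDegree ?_
    rw [hdeg]
    exact_mod_cast hm

/-- Column alternating sum. -/
def colsum (p : ℕ) (D : ℤ × ℤ → ℚ) (l : ℤ) : ℚ :=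
  ∑ i ∈ Finset.range (p + 1), (-1) ^ i * D ((i : ℤ), l)

lemma aux_SPoly (p : ℕ) (D : ℤ × ℤ → ℚ)
    (hz : ∀ i j : ℤ, i < 0 ∨ (p : ℤ) < i → D (i, j) = 0)
    (s : Finset ℤ) (hs : ∀ i l, D (i, l) ≠ 0 → l ∈ s) :
    SPoly D = ∑ l ∈ s, LaurentPolynomial.C (colsum p D l) * LaurentPolynomial.T l := by
  unfold SPoly
  rw [finsum_eq_sum_of_support_subset
    (s := ((Finset.range (p + 1)).map (Nat.castEmbedding (R := ℤ))) ×ˢ s)]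
  · rw [Finset.sum_product_right]
    refine Finset.sum_congr rfl fun l _ => ?_
    rw [Finset.sum_map]
    dsimp only
    rw [← Finset.sum_mul, ← map_sum]
    simp [colsum]
  · rintro ⟨i, l⟩ h
    have hD : D (i, l) ≠ 0 := by
      intro h0
      apply h
      simp [h0]
    have hi : ¬ (i < 0 ∨ (p : ℤ) < i) := fun h0 => hD (hz i l h0)
    push Not at hi
    simp only [Finset.coe_product, Set.mem_prod, Finset.mem_coe, Finset.mem_map, Finset.mem_range]
    refine ⟨⟨i.toNat, by omega, ?_⟩, hs i l hD⟩
    simp only [Nat.castEmbedding_apply]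
    omega

lemma aux_vanish (p : ℕ) (s : Finset ℤ) (c : ℤ → ℚ) (hs : s.card ≤ p)
    (h : ∀ q : Polynomial ℚ, q.degree < p → ∑ l ∈ s, c l * q.eval (l : ℚ) = 0) :
    ∀ l ∈ s, c l = 0 := by
  intro l hl
  have h1 := h (∏ e ∈ s.erase l, (Polynomial.X - Polynomial.C (e : ℚ))) (by
    rw [Polynomial.degree_prod]
    have : 0 < s.card := Finset.card_pos.2 ⟨l, hl⟩
    simp only [Polynomial.degree_X_sub_C, Finset.sum_const, Finset.card_erase_of_mem hl]
    rw [nsmul_eq_mul, mul_one]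
    exact_mod_cast (by omega : s.card - 1 < p))
  rw [Finset.sum_eq_single l] at h1
  · rcases mul_eq_zero.1 h1 with h2 | h2
    · exact h2
    · exfalso
      rw [Polynomial.eval_prod, Finset.prod_eq_zero_iff] at h2
      obtain ⟨e, he, h3⟩ := h2
      simp only [Polynomial.eval_sub, Polynomial.eval_X, Polynomial.eval_C, sub_eq_zero] at h3
      exact Finset.ne_of_mem_erase he (by exact_mod_cast h3.symm)
  · intro m hm hne
    rw [Polynomial.eval_prod, Finset.prod_eq_zero (Finset.mem_erase.2 ⟨hne, hm⟩)]
    · simp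
    · simp
  · intro h; exact absurd hl h

lemma aux_moment (p : ℕ) (D : ℤ × ℤ → ℚ) (hz : ∀ i j : ℤ, i < 0 ∨ (p : ℤ) < i → D (i, j) = 0)
    (s : Finset ℤ) (hs : ∀ i l, D (i, l) ≠ 0 → l ∈ s) :
    (1 - LaurentPolynomial.T 1) ^ p ∣ SPoly D ↔
    ∀ q : Polynomial ℚ, q.degree < p → ∑ l ∈ s, colsum p D l * q.eval (l : ℚ) = 0 := by
  rw [aux_SPoly p D hz s hs, aux_dvd_iff]

lemma aux_sign (p : ℕ) (d : Fin (p + 1) → ℤ) (hd : StrictMono d) (k : Fin (p + 1)) :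
    ∏ j ∈ Finset.univ.erase k, ((d k : ℚ) - d j) =
      (-1) ^ (p - (k : ℕ)) * |∏ j ∈ Finset.univ.erase k, ((d k : ℚ) - d j)| := by
  rw [Finset.abs_prod]
  have h : ∀ j ∈ Finset.univ.erase k, ((d k : ℚ) - d j) =
      (if k < j then (-1 : ℚ) else 1) * |(d k : ℚ) - d j| := by
    intro j hj
    have hne := Finset.ne_of_mem_erase hj
    split_ifs with h
    · have : (d k : ℚ) < d j := by exact_mod_cast hd h
      rw [abs_of_neg (by linarith)]; ring
    · have : (d j : ℚ) < d k := by exact_mod_cast hd (lt_of_le_of_ne (not_lt.1 h) hne)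
      rw [abs_of_pos (by linarith)]; ring
  rw [Finset.prod_congr rfl h, Finset.prod_mul_distrib]
  congr 1
  · rw [Finset.prod_ite]
    simp only [Finset.prod_const, one_pow, mul_one]
    congr 1
    have : (Finset.univ.erase k).filter (fun j => k < j) = Finset.Ioi k := by
      ext j
      simp only [Finset.mem_filter, Finset.mem_erase, Finset.mem_univ, Finset.mem_Ioi, and_true]
      exact ⟨fun h => h.2, fun h => ⟨h.ne', h⟩⟩
    rw [this, Fin.card_Ioi]
    omega

/-- Existence of positive normalized pure diagrams. -/
lemma aux_exists (p : ℕ) (d : Fin (p + 1) → ℤ) (hd : StrictMono d) :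
    ∃ D : ℤ × ℤ → ℚ, IsPureDiagram p d D ∧ D (0, d 0) = 1 ∧ (∀ q, 0 ≤ D q) ∧
      ∀ k : Fin (p + 1), 0 < D (((k : ℕ) : ℤ), d k) := by
  set W : Fin (p + 1) → ℚ := fun k => ∏ j ∈ Finset.univ.erase k, ((d k : ℚ) - d j) with hW
  have hW0 : ∀ k, W k ≠ 0 := by
    intro k
    rw [hW]
    refine Finset.prod_ne_zero_iff.2 fun j hj => ?_
    have := hd.injective.ne (Finset.ne_of_mem_erase hj)
    exact sub_ne_zero.2 (by exact_mod_cast this.symm)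
  set bet : Fin (p + 1) → ℚ := fun k => |W 0| / |W k| with hbet
  have hpos : ∀ k, 0 < bet k := fun k => div_pos (abs_pos.2 (hW0 0)) (abs_pos.2 (hW0 k))
  set D : ℤ × ℤ → ℚ := fun q => ∑ k : Fin (p + 1),
    if q = (((k : ℕ) : ℤ), d k) then bet k else 0 with hD
  have hDk : ∀ (k : Fin (p + 1)) (l : ℤ), D (((k : ℕ) : ℤ), l) = if l = d k then bet k else 0 := by
    intro k l
    rw [hD]
    dsimp only
    rw [Finset.sum_eq_single k]
    · simp
    · intro m _ hm
      rw [if_neg]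
      intro h
      rw [Prod.mk.injEq] at h
      exact hm (Fin.ext (by exact_mod_cast h.1.symm))
    · simp
  have hDne : ∀ q, D q ≠ 0 → ∃ k : Fin (p + 1), q = (((k : ℕ) : ℤ), d k) := by
    intro q hq
    obtain ⟨k, _, hk⟩ := Finset.exists_ne_zero_of_sum_ne_zero hq
    refine ⟨k, ?_⟩
    by_contra h
    exact hk (if_neg h)
  have hz : ∀ i j : ℤ, i < 0 ∨ (p : ℤ) < i → D (i, j) = 0 := by
    intro i j h
    by_contra h0
    obtain ⟨k, hk⟩ := hDne _ h0
    rw [Prod.mk.injEq] at hk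
    have := k.2
    omega
  refine ⟨D, ⟨⟨?_, hz, ?_⟩, hd, ?_⟩, ?_, ?_, ?_⟩
  · refine (Set.finite_range (fun k : Fin (p + 1) => (((k : ℕ) : ℤ), d k))).subset ?_
    intro q hq
    obtain ⟨k, hk⟩ := hDne q hq
    exact ⟨k, hk.symm⟩
  · rw [aux_moment p D hz (Finset.univ.image d)]
    · intro q hq
      have h1 : ∑ l ∈ Finset.univ.image d, colsum p D l * q.eval (l : ℚ) =
          ∑ k : Fin (p + 1), (-1) ^ (k : ℕ) * bet k * q.eval (d k : ℚ) := by
        simp only [colsum, Finset.sum_range, Finset.sum_mul]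
        rw [Finset.sum_comm]
        refine Finset.sum_congr rfl fun k _ => ?_
        rw [Finset.sum_eq_single (d k)]
        · rw [hDk]; simp
        · intro l _ hl
          rw [hDk, if_neg hl]; simp
        · intro h
          exact absurd (Finset.mem_image_of_mem d (Finset.mem_univ k)) h
      have h2 : ∀ k : Fin (p + 1), (-1) ^ (k : ℕ) * bet k * q.eval (d k : ℚ) =
          |W 0| * (-1) ^ p * (q.eval (d k : ℚ) / W k) := by
        intro k
        have hk : W k = (-1) ^ (p - (k : ℕ)) * |W k| := aux_sign p d hd k
        have hp : (-1 : ℚ) ^ p = (-1) ^ (k : ℕ) * (-1) ^ (p - (k : ℕ)) := by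
          rw [← pow_add]; congr 1; omega
        have ha : |W k| ≠ 0 := abs_ne_zero.2 (hW0 k)
        have hs : ((-1 : ℚ) ^ (p - (k : ℕ))) ≠ 0 := by simp
        rw [hbet]
        dsimp only
        conv_rhs => rw [hk, hp]
        field_simp
      have h3 := Lagrange.coeff_eq_sum (s := (Finset.univ : Finset (Fin (p + 1))))
        (v := fun k => (d k : ℚ)) (P := q)
        (fun a _ b _ h => hd.injective (by simpa using h))
        (lt_trans hq (by simp; exact_mod_cast Nat.lt_succ_self p))
      rw [h1, Finset.sum_congr rfl (fun k _ => h2 k), ← Finset.mul_sum, ← h3]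
      rw [Polynomial.coeff_eq_zero_of_degree_lt, mul_zero]
      simpa using hq
    · intro i l h
      obtain ⟨k, hk⟩ := hDne _ h
      rw [Prod.mk.injEq] at hk
      rw [hk.2]
      exact Finset.mem_image_of_mem d (Finset.mem_univ k)
  · intro k j hj
    rw [hDk, if_neg hj]
  · have := hDk 0 (d 0)
    simp only [Fin.val_zero, Nat.cast_zero, if_true] at this
    rw [this]
    exact div_self (abs_ne_zero.2 (hW0 0))
  · intro q
    refine Finset.sum_nonneg fun k _ => ?_
    split_ifs
    · exact (hpos k).le
    · exact le_rfl
  · intro k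
    rw [hDk, if_pos rfl]
    exact hpos k

/-- Bookkeeping predicate: normalized diagram with support as in `midType p d0 j (c+p)`. -/
structure NP (p : ℕ) (d0 j c : ℤ) (A : ℤ × ℤ → ℚ) : Prop where
  dvd : (1 - LaurentPolynomial.T 1) ^ p ∣ SPoly A
  supp : ∀ i l : ℤ, ¬(i = 0 ∧ l = d0) → ¬(1 ≤ i ∧ i ≤ (p : ℤ) - 1 ∧ l = j + i) →
    ¬(i = (p : ℤ) ∧ l = c + p) → A (i, l) = 0
  norm : A (0, d0) = 1

lemma aux_midType_strictMono (p : ℕ) (d0 j c : ℤ) (h1 : d0 ≤ j) (h2 : j ≤ c) :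
    StrictMono (midType p d0 j (c + p)) := by
  intro a b hab
  have hab' : (a : ℕ) < b := hab
  have := b.2
  unfold midType
  split_ifs <;> omega

lemma aux_NP (p : ℕ) (d0 j c : ℤ) (A : ℤ × ℤ → ℚ)
    (hA : IsPureDiagram p (midType p d0 j (c + p)) A) (hn : A (0, d0) = 1) :
    NP p d0 j c A := by
  refine ⟨hA.diagram.dvd, ?_, hn⟩
  intro i l h0 h1 h2
  by_cases hi : i < 0 ∨ (p : ℤ) < i
  · exact hA.diagram.zero_outside i l hi
  push Not at hi
  have h := hA.pure ⟨i.toNat, by omega⟩ l (by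
    unfold midType
    dsimp only
    split_ifs <;> omega)
  have e : ((i.toNat : ℕ) : ℤ) = i := by omega
  simpa only [e] using h

lemma aux_exists_NP (p : ℕ) (hp : 2 ≤ p) (d0 j c : ℤ) (h1 : d0 ≤ j) (h2 : j ≤ c) :
    ∃ D, IsPureDiagram p (midType p d0 j (c + p)) D ∧ D (0, d0) = 1 ∧ (∀ q, 0 ≤ D q) ∧
      0 < D (1, j + 1) ∧ 0 < D ((p : ℤ), c + p) := by
  obtain ⟨D, hD, hn, hnn, hpos⟩ := aux_exists p _ (aux_midType_strictMono p d0 j c h1 h2)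
  refine ⟨D, hD, ?_, hnn, ?_, ?_⟩
  · simpa [midType] using hn
  · have := hpos ⟨1, by omega⟩
    have h3 : ¬ 1 = p := by omega
    simpa [midType, h3] using this
  · have := hpos ⟨p, by omega⟩
    have h3 : ¬ p = 0 := by omega
    simpa [midType, h3] using this

lemma NP.moment {p : ℕ} {d0 j c : ℤ} {A : ℤ × ℤ → ℚ} (h : NP p d0 j c A) (s : Finset ℤ)
    (h0 : d0 ∈ s) (h1 : ∀ i : ℤ, 1 ≤ i → i ≤ (p : ℤ) - 1 → j + i ∈ s) (h2 : c + p ∈ s) :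
    ∀ q : Polynomial ℚ, q.degree < p → ∑ l ∈ s, colsum p A l * q.eval (l : ℚ) = 0 := by
  refine (aux_moment p A ?_ s ?_).1 h.dvd
  · intro i l hi
    exact h.supp i l (by omega) (by omega) (by omega)
  · intro i l hne
    by_contra hl
    refine hne (h.supp i l ?_ ?_ ?_)
    · rintro ⟨_, rfl⟩; exact hl h0
    · rintro ⟨a, b, rfl⟩; exact hl (h1 i a b)
    · rintro ⟨_, rfl⟩; exact hl h2

lemma aux_unique (p : ℕ) (hp : 2 ≤ p) (d0 j c : ℤ) (hj : d0 ≤ j) (hc : j ≤ c)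
    (A B : ℤ × ℤ → ℚ) (hA : NP p d0 j c A) (hB : NP p d0 j c B) : A = B := by
  set s' : Finset ℤ := insert (c + p) (Finset.Icc (j + 1) (j + p - 1)) with hs'
  have hsub : s' ⊆ insert d0 s' := Finset.subset_insert _ _
  have hm : ∀ i : ℤ, 1 ≤ i → i ≤ (p : ℤ) - 1 → j + i ∈ insert d0 s' := by
    intro i h1 h2
    refine hsub ?_
    simp only [hs', Finset.mem_insert, Finset.mem_Icc]
    omega
  have mA := hA.moment (insert d0 s') (by simp) hm (by simp [hs'])
  have mB := hB.moment (insert d0 s') (by simp) hm (by simp [hs'])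
  have hcol0 : colsum p A d0 = colsum p B d0 := by
    unfold colsum
    refine Finset.sum_congr rfl fun i _ => ?_
    rcases Nat.eq_zero_or_pos i with rfl | hi
    · simp [hA.norm, hB.norm]
    · rw [hA.supp _ _ (by omega) (by omega) (by omega), hB.supp _ _ (by omega) (by omega) (by omega)]
  have hv := aux_vanish p s' (fun l => colsum p A l - colsum p B l) (by
      refine (Finset.card_insert_le _ _).trans ?_
      rw [Int.card_Icc]; omega) (by
      intro q hq
      rw [Finset.sum_subset hsub]
      · have h1 := mA q hq
        have h2 := mB q hq
        simp only [sub_mul, Finset.sum_sub_distrib, h1, h2, sub_zero]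
      · intro l hl hl'
        have : l = d0 := (Finset.mem_insert.1 hl).resolve_right hl'
        rw [this, hcol0]; simp)
  have key : ∀ (i : ℕ) (l : ℤ), i ≤ p → l ∈ s' →
      (∀ m : ℕ, m ≠ i → A ((m : ℤ), l) = 0 ∧ B ((m : ℤ), l) = 0) →
      A ((i : ℤ), l) = B ((i : ℤ), l) := by
    intro i l hi hl hm
    have h := hv l hl
    simp only [colsum] at h
    rw [Finset.sum_eq_single i (fun m _ hne => by rw [(hm m hne).1, mul_zero])
      (fun h => absurd (Finset.mem_range.2 (by omega)) h),
      Finset.sum_eq_single i (fun m _ hne => by rw [(hm m hne).2, mul_zero])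
      (fun h => absurd (Finset.mem_range.2 (by omega)) h), ← mul_sub] at h
    have := (mul_eq_zero.1 h).resolve_left (by simp)
    linarith
  funext ⟨i, l⟩
  by_cases h0 : i = 0 ∧ l = d0
  · rw [h0.1, h0.2, hA.norm, hB.norm]
  by_cases h1 : 1 ≤ i ∧ i ≤ (p : ℤ) - 1 ∧ l = j + i
  · lift i to ℕ using (by omega)
    refine key i l (by omega) ?_ ?_
    · simp only [hs', Finset.mem_insert, Finset.mem_Icc]; omega
    · intro m hm
      exact ⟨hA.supp _ _ (by omega) (by omega) (by omega),
        hB.supp _ _ (by omega) (by omega) (by omega)⟩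
  by_cases h2 : i = (p : ℤ) ∧ l = c + p
  · rw [h2.1]
    refine key p l le_rfl ?_ ?_
    · simp only [hs', Finset.mem_insert, Finset.mem_Icc]; omega
    · intro m hm
      exact ⟨hA.supp _ _ (by omega) (by omega) (by omega),
        hB.supp _ _ (by omega) (by omega) (by omega)⟩
  · rw [hA.supp _ _ h0 h1 h2, hB.supp _ _ h0 h1 h2]

lemma aux_step (p : ℕ) (hp : 2 ≤ p) (d0 j c : ℤ) (hj : d0 ≤ j) (hc : j < c)
    (A Q R : ℤ × ℤ → ℚ) (hA : NP p d0 j c A) (hQ : NP p d0 j j Q) (hR : NP p d0 (j + 1) c R)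
    (hA1 : 0 < A (1, j + 1)) (hQ1 : 0 < Q (1, j + 1)) (hAp : 0 < A ((p : ℤ), c + p))
    (hRp : 0 < R ((p : ℤ), c + p)) (hR0 : ∀ q, 0 ≤ R q) :
    ∃ (x : ℚ) (b : ℤ × ℤ → ℚ), 0 ≤ x ∧ 0 ≤ 1 - x ∧ (Function.support b).Finite ∧ (∀ q, 0 ≤ b q) ∧
      ∀ i l, A (i, l) = x * Q (i, l) + (1 - x) * R (i, l) - (b (i, l) + b (i - 1, l)) := by
  set x : ℚ := A (1, j + 1) / Q (1, j + 1) with hx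
  set Z : ℤ × ℤ → ℚ := fun q => x * Q q + (1 - x) * R q - A q with hZ
  set s' : Finset ℤ := insert (c + p) (Finset.Icc (j + 2) (j + p)) with hs'
  set s : Finset ℤ := insert d0 (insert (j + 1) s') with hs
  have hsub : s' ⊆ s := (Finset.subset_insert _ _).trans (Finset.subset_insert _ _)
  have hZs : ∀ i l : ℤ, A (i, l) = 0 → Q (i, l) = 0 → R (i, l) = 0 → Z (i, l) = 0 := by
    intro i l h1 h2 h3
    simp [hZ, h1, h2, h3]
  have mA := hA.moment s (by simp [hs])
    (by intro i h1 h2; simp only [hs, hs', Finset.mem_insert, Finset.mem_Icc]; omega)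
    (by simp [hs, hs'])
  have mQ := hQ.moment s (by simp [hs])
    (by intro i h1 h2; simp only [hs, hs', Finset.mem_insert, Finset.mem_Icc]; omega)
    (by simp only [hs, hs', Finset.mem_insert, Finset.mem_Icc]; omega)
  have mR := hR.moment s (by simp [hs])
    (by intro i h1 h2; simp only [hs, hs', Finset.mem_insert, Finset.mem_Icc]; omega)
    (by simp [hs, hs'])
  have hcol : ∀ l, colsum p Z l = x * colsum p Q l + (1 - x) * colsum p R l - colsum p A l := by
    intro l
    simp only [colsum, hZ, Finset.mul_sum]
    rw [← Finset.sum_add_distrib, ← Finset.sum_sub_distrib]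
    exact Finset.sum_congr rfl fun i _ => by ring
  have hcd : colsum p Z d0 = 0 := by
    refine Finset.sum_eq_zero fun i _ => ?_
    rcases Nat.eq_zero_or_pos i with rfl | hi
    · simp [hZ, hA.norm, hQ.norm, hR.norm]
    · rw [hZs _ _ (hA.supp _ _ (by omega) (by omega) (by omega))
        (hQ.supp _ _ (by omega) (by omega) (by omega))
        (hR.supp _ _ (by omega) (by omega) (by omega)), mul_zero]
  have hZ1 : Z (1, j + 1) = 0 := by
    simp only [hZ]
    rw [hR.supp _ _ (by omega) (by omega) (by omega), hx, div_mul_cancel₀ _ hQ1.ne']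
    ring
  have hcj : colsum p Z (j + 1) = 0 := by
    refine Finset.sum_eq_zero fun i _ => ?_
    by_cases hi : i = 1
    · rw [hi, Nat.cast_one, hZ1, mul_zero]
    · rw [hZs _ _ (hA.supp _ _ (by omega) (by omega) (by omega))
        (hQ.supp _ _ (by omega) (by omega) (by omega))
        (hR.supp _ _ (by omega) (by omega) (by omega)), mul_zero]
  have hv := aux_vanish p s' (fun l => colsum p Z l) (by
      refine (Finset.card_insert_le _ _).trans ?_
      rw [Int.card_Icc]; omega) (by
      intro q hq
      rw [Finset.sum_subset hsub]
      · have h1 := mA q hq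
        have h2 := mQ q hq
        have h3 := mR q hq
        simp only [hcol, sub_mul, add_mul, Finset.sum_sub_distrib, Finset.sum_add_distrib,
          mul_assoc, ← Finset.mul_sum, h1, h2, h3]
        ring
      · intro l hl hl'
        rcases Finset.mem_insert.1 hl with rfl | hl
        · rw [hcd, zero_mul]
        · have : l = j + 1 := (Finset.mem_insert.1 hl).resolve_right hl'
          rw [this, hcj, zero_mul])
  have hZp : Z ((p : ℤ), c + p) = 0 := by
    have h := hv (c + p) (by simp [hs'])
    simp only [colsum] at h
    rw [Finset.sum_eq_single p] at h
    · exact (mul_eq_zero.1 h).resolve_left (by simp)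
    · intro i hi hne
      have := Finset.mem_range.1 hi
      rw [hZs _ _ (hA.supp _ _ (by omega) (by omega) (by omega))
        (hQ.supp _ _ (by omega) (by omega) (by omega))
        (hR.supp _ _ (by omega) (by omega) (by omega)), mul_zero]
    · intro h; exact absurd (Finset.mem_range.2 (by omega)) h
  have hZi : ∀ i : ℤ, 2 ≤ i → i ≤ p → Z (i, j + i) = Z (i - 1, j + i) := by
    intro i h2 hip
    obtain ⟨n, rfl⟩ : ∃ n : ℕ, i = (n : ℤ) + 1 := ⟨(i - 1).toNat, by omega⟩
    have h := hv (j + ((n : ℤ) + 1))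
      (by simp only [hs', Finset.mem_insert, Finset.mem_Icc]; omega)
    simp only [colsum] at h
    rw [Finset.sum_eq_add_of_mem n (n + 1) (Finset.mem_range.2 (by omega))
      (Finset.mem_range.2 (by omega)) (by omega)] at h
    · have e : ((-1 : ℚ) ^ n) ≠ 0 := by simp
      rw [pow_succ] at h
      push_cast at h
      have h' : (-1 : ℚ) ^ n * (Z ((n : ℤ), j + ((n : ℤ) + 1)) -
        Z ((n : ℤ) + 1, j + ((n : ℤ) + 1))) = 0 := by rw [← h]; ring
      have := (mul_eq_zero.1 h').resolve_left e
      rw [add_sub_cancel_right]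
      linarith
    · rintro m hm ⟨hm1, hm2⟩
      have := Finset.mem_range.1 hm
      rw [hZs _ _ (hA.supp _ _ (by omega) (by omega) (by omega))
        (hQ.supp _ _ (by omega) (by omega) (by omega))
        (hR.supp _ _ (by omega) (by omega) (by omega)), mul_zero]
  have hx1 : 0 < 1 - x := by
    simp only [hZ] at hZp
    rw [hQ.supp _ _ (by omega) (by omega) (by omega)] at hZp
    have : (1 - x) * R ((p : ℤ), c + p) = A ((p : ℤ), c + p) := by linarith
    rw [← this] at hAp
    exact (mul_pos_iff_of_pos_right hRp).1 hAp
  set b : ℤ × ℤ → ℚ := fun q => if 1 ≤ q.1 ∧ q.1 ≤ (p : ℤ) - 1 ∧ q.2 = j + 1 + q.1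
    then (1 - x) * R q else 0 with hb
  have hb0 : ∀ i l : ℤ, ¬(1 ≤ i ∧ i ≤ (p : ℤ) - 1 ∧ l = j + 1 + i) → b (i, l) = 0 :=
    fun i l h => if_neg h
  have hb1 : ∀ i l : ℤ, (1 ≤ i ∧ i ≤ (p : ℤ) - 1 ∧ l = j + 1 + i) →
    b (i, l) = (1 - x) * R (i, l) := fun i l h => if_pos h
  refine ⟨x, b, (div_pos hA1 hQ1).le, hx1.le, ?_, ?_, ?_⟩
  · refine ((Finset.Icc (1 : ℤ) p).image (fun i => (i, j + 1 + i))).finite_toSet.subset ?_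
    rintro ⟨i, l⟩ h
    have : 1 ≤ i ∧ i ≤ (p : ℤ) - 1 ∧ l = j + 1 + i := by
      by_contra h'
      exact h (hb0 i l h')
    simp only [Finset.coe_image, Set.mem_image, Finset.mem_coe, Finset.mem_Icc]
    exact ⟨i, by omega, by rw [this.2.2]⟩
  · intro q
    simp only [hb]
    split_ifs
    · exact mul_nonneg hx1.le (hR0 q)
    · exact le_rfl
  · intro i l
    suffices h : Z (i, l) = b (i, l) + b (i - 1, l) by
      rw [← h]; simp only [hZ]; ring
    by_cases c0 : i = 0 ∧ l = d0
    · obtain ⟨rfl, rfl⟩ := c0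
      rw [hb0 _ _ (by omega), hb0 _ _ (by omega)]
      simp [hZ, hA.norm, hQ.norm, hR.norm]
    by_cases c1 : i = 1 ∧ l = j + 1
    · obtain ⟨rfl, rfl⟩ := c1
      rw [hb0 _ _ (by omega), hb0 _ _ (by omega), hZ1, add_zero]
    by_cases c2 : 2 ≤ i ∧ i ≤ p ∧ l = j + i
    · obtain ⟨h2, hip, rfl⟩ := c2
      rw [hZi i h2 hip, hb0 i _ (by omega), hb1 (i - 1) _ (by omega)]
      simp only [hZ]
      rw [hA.supp _ _ (by omega) (by omega) (by omega),
        hQ.supp _ _ (by omega) (by omega) (by omega)]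
      ring
    by_cases c3 : 1 ≤ i ∧ i ≤ (p : ℤ) - 1 ∧ l = j + 1 + i
    · rw [hb1 i l c3, hb0 (i - 1) _ (by omega)]
      simp only [hZ]
      rw [hA.supp _ _ (by omega) (by omega) (by omega),
        hQ.supp _ _ (by omega) (by omega) (by omega)]
      ring
    by_cases c4 : i = p ∧ l = c + p
    · obtain ⟨rfl, rfl⟩ := c4
      rw [hZp, hb0 _ _ (by omega), hb0 _ _ (by omega), add_zero]
    · rw [hZs _ _ (hA.supp _ _ (by omega) (by omega) (by omega))
        (hQ.supp _ _ (by omega) (by omega) (by omega))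
        (hR.supp _ _ (by omega) (by omega) (by omega)), hb0 _ _ (by omega), hb0 _ _ (by omega),
        add_zero]

lemma aux_Ccan (b : ℤ × ℤ → ℚ) (i l : ℤ) :
    ∑ᶠ r : ℤ × ℤ, b r * Ccan r.1 r.2 (i, l) = b (i, l) + b (i - 1, l) := by
  rw [finsum_eq_sum_of_support_subset (s := {(i, l), (i - 1, l)})]
  · rw [Finset.sum_pair (by simp only [ne_eq, Prod.mk.injEq]; omega)]
    simp [Ccan]
  · rintro ⟨k, m⟩ h
    have : Ccan k m (i, l) ≠ 0 := right_ne_zero_of_mul h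
    simp only [Ccan, ne_eq, ite_eq_right_iff, one_ne_zero, imp_false, not_not, Prod.mk.injEq] at this
    simp only [Finset.coe_insert, Finset.coe_singleton, Set.mem_insert_iff, Prod.mk.injEq,
      Set.mem_singleton_iff]
    omega

lemma aux_induct (p : ℕ) (hp : 2 ≤ p) (d0 : ℤ) (P : ℤ → ℤ × ℤ → ℚ)
    (hP : ∀ j, d0 ≤ j → NP p d0 j j (P j) ∧ 0 < P j (1, j + 1)) (n : ℕ) :
    ∀ (j : ℤ), d0 ≤ j → ∀ A, NP p d0 j (j + n) A →
    ∃ (a : ℤ → ℚ) (b : ℤ × ℤ → ℚ),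
      (Function.support a).Finite ∧ (∀ j, 0 ≤ a j) ∧ (∀ j, a j ≠ 0 → d0 ≤ j) ∧
      (Function.support b).Finite ∧ (∀ q, 0 ≤ b q) ∧
      ∀ i l, A (i, l) = (∑ᶠ j : ℤ, a j * P j (i, l)) - (b (i, l) + b (i - 1, l)) := by
  induction n with
  | zero =>
    intro j hj A hA
    have hAP : A = P j := aux_unique p hp d0 j j hj le_rfl A (P j) (by simpa using hA) (hP j hj).1
    refine ⟨Pi.single j 1, 0, ?_, ?_, ?_, by simp, by simp, ?_⟩
    · exact (Set.finite_singleton j).subset (Pi.support_single_subset)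
    · intro k
      by_cases h : k = j
      · subst h; simp
      · simp [h]
    · intro k hk
      by_cases h : k = j
      · rw [h]; exact hj
      · simp [h] at hk
    · intro i l
      rw [finsum_eq_single _ j]
      · simp [hAP]
      · intro k hk; simp [hk]
  | succ n ih =>
    intro j hj A hA
    obtain ⟨A', hA', nA', pA', A1, Ap⟩ := aux_exists_NP p hp d0 j (j + (n + 1 : ℕ)) hj (by omega)
    have hAA : A = A' := aux_unique p hp d0 j _ hj (by omega) A A' hA (aux_NP _ _ _ _ _ hA' nA')
    subst hAA
    obtain ⟨R, hR, nR, pR, R1, Rp⟩ :=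
      aux_exists_NP p hp d0 (j + 1) (j + (n + 1 : ℕ)) (by omega) (by omega)
    have hRn := aux_NP _ _ _ _ _ hR nR
    obtain ⟨x, b, hx0, hx1, hbf, hb0, hstep⟩ := aux_step p hp d0 j (j + (n + 1 : ℕ)) hj
      (by omega) A (P j) R hA (hP j hj).1 hRn A1 (hP j hj).2 Ap Rp pR
    have e : j + 1 + (n : ℤ) = j + (n + 1 : ℕ) := by push_cast; ring
    obtain ⟨a', b', ha'f, ha'0, ha'd, hb'f, hb'0, hR'⟩ := ih (j + 1) (by omega) R (by rw [e]; exact hRn)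
    have hsf : (Function.support (Pi.single j x : ℤ → ℚ)).Finite :=
      (Set.finite_singleton j).subset (Pi.support_single_subset)
    refine ⟨fun k => (Pi.single j x : ℤ → ℚ) k + (1 - x) * a' k, fun q => b q + (1 - x) * b' q,
      ?_, ?_, ?_, ?_, ?_, ?_⟩
    · refine (hsf.union ha'f).subset ?_
      intro k hk
      by_contra h
      simp only [Set.mem_union, Function.mem_support, not_or, not_not] at h
      exact hk (by simp only [h.1, h.2]; ring)
    · intro k
      refine add_nonneg ?_ (mul_nonneg hx1 (ha'0 k))
      by_cases h : k = j
      · subst h; simpa using hx0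
      · simp [h]
    · intro k hk
      by_cases h : k = j
      · rw [h]; exact hj
      · refine ha'd k ?_
        intro h0
        exact hk (by simp [h, h0])
    · refine (hbf.union hb'f).subset ?_
      intro k hk
      by_contra h
      simp only [Set.mem_union, Function.mem_support, not_or, not_not] at h
      exact hk (by simp only [h.1, h.2]; ring)
    · intro q
      exact add_nonneg (hb0 q) (mul_nonneg hx1 (hb'0 q))
    · intro i l
      have hsum : ∑ᶠ k : ℤ, ((Pi.single j x : ℤ → ℚ) k + (1 - x) * a' k) * P k (i, l) =
          x * P j (i, l) + (1 - x) * ∑ᶠ k : ℤ, a' k * P k (i, l) := by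
        rw [mul_finsum' _ _ (ha'f.subset (fun k hk => left_ne_zero_of_mul hk))]
        have h1 : ∑ᶠ k : ℤ, (Pi.single j x : ℤ → ℚ) k * P k (i, l) = x * P j (i, l) := by
          rw [finsum_eq_single _ j]
          · simp
          · intro k hk; simp [hk]
        rw [← h1, ← finsum_add_distrib]
        · exact finsum_congr fun k => by ring
        · exact hsf.subset (fun k hk => left_ne_zero_of_mul hk)
        · exact ha'f.subset (fun k hk => left_ne_zero_of_mul (right_ne_zero_of_mul hk))
      rw [hsum, hstep i l, hR' i l]
      ring

/-- a normalized pure diagram of type `(d₀, j₀+1, …, j₀+p-1, dₚ)` equals a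
nonnegative combination of normalized pure diagrams of types `(d₀, j+1, …, j+p-1, j+p)`
minus a nonnegative combination of consecutive cancellations. -/
theorem stmt1 (p : ℕ) (hp : 2 ≤ p) (d0 j0 dp : ℤ) (hd0j : d0 ≤ j0)
    (hjdp : j0 + (p : ℤ) - 1 < dp)
    (A : ℤ × ℤ → ℚ) (hA : IsPureDiagram p (midType p d0 j0 dp) A) (hnorm : A (0, d0) = 1) :
    ∃ (a : ℤ → ℚ) (P : ℤ → (ℤ × ℤ → ℚ)) (b : ℤ × ℤ → ℚ),
      (Function.support a).Finite ∧ (∀ j, 0 ≤ a j) ∧ (∀ j, a j ≠ 0 → d0 ≤ j) ∧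
      (∀ j, a j ≠ 0 →
        IsPureDiagram p (midType p d0 j (j + (p : ℤ))) (P j) ∧ P j (0, d0) = 1 ∧
          ∀ q, 0 ≤ P j q) ∧
      (Function.support b).Finite ∧ (∀ q, 0 ≤ b q) ∧
      ∀ q, A q = (∑ᶠ j : ℤ, a j * P j q) - ∑ᶠ r : ℤ × ℤ, b r * Ccan r.1 r.2 q := by

  classical
  have hex : ∀ j : ℤ, ∃ D : ℤ × ℤ → ℚ, d0 ≤ j →
      (IsPureDiagram p (midType p d0 j (j + p)) D ∧ D (0, d0) = 1 ∧ (∀ q, 0 ≤ D q) ∧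
      0 < D (1, j + 1)) := by
    intro j
    by_cases hj : d0 ≤ j
    · obtain ⟨D, h1, h2, h3, h4, _⟩ := aux_exists_NP p hp d0 j j hj le_rfl
      exact ⟨D, fun _ => ⟨h1, h2, h3, h4⟩⟩
    · exact ⟨0, fun h => absurd h hj⟩
  choose P hP using hex
  have hdp : dp = (j0 + ((dp - p - j0).toNat : ℕ)) + (p : ℤ) := by omega
  rw [hdp] at hA
  obtain ⟨a, b, h1, h2, h3, h4, h5, h6⟩ := aux_induct p hp d0 P
    (fun j hj => ⟨aux_NP _ _ _ _ _ (hP j hj).1 (hP j hj).2.1, (hP j hj).2.2.2⟩)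
    (dp - p - j0).toNat j0 hd0j A (aux_NP _ _ _ _ _ hA hnorm)
  refine ⟨a, P, b, h1, h2, h3, ?_, h4, h5, ?_⟩
  · intro j hj
    have := hP j (h3 j hj)
    exact ⟨this.1, this.2.1, this.2.2.1⟩
  · rintro ⟨i, l⟩
    rw [aux_Ccan, h6 i l]
end

section
/- Let p ≥ 2 and c ≥ 0 be integers. Then det [[r_{k-1}, r_k], [r_{c-k+1}, r_{c-k}]] < 0 for every integer k with 0 ≤ k ≤ c+1, and consequently det [[r_{i-1}, r_i], [r_{c-i+1}, r_{c-i}]] · det [[r_i, r_{i+1}], [r_{c-i}, r_{c-i-1}]] > 0 for every integer i with 0 ≤ i ≤ c. -/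
lemma rr_nonneg_aux (p : ℕ) (i : ℤ) : 0 ≤ rr p i := by
  unfold rr; split_ifs <;> positivity

lemma rr_lt_aux (p : ℕ) (hp : 2 ≤ p) (n : ℕ) : rr p ((n : ℤ) - 1) < rr p (n : ℤ) := by
  obtain ⟨s, rfl⟩ : ∃ s, p = s + 2 := ⟨p - 2, by omega⟩
  cases n with
  | zero => simp [rr]
  | succ n =>
    have h1 : ((n + 1 : ℕ) : ℤ) - 1 = (n : ℤ) := by push_cast; ring
    have h2 : ¬ ((n : ℤ) < 0) := by omega
    have h3 : ¬ (((n + 1 : ℕ) : ℤ) < 0) := by omega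
    rw [h1]
    unfold rr
    rw [if_neg h2, if_neg h3, Int.toNat_natCast, Int.toNat_natCast]
    have h4 : s + 2 - 1 = s + 1 := rfl
    rw [h4]
    have h5 : (s + 1 + (n + 1)).choose (s + 1)
        = (s + 1 + n).choose s + (s + 1 + n).choose (s + 1) := Nat.choose_succ_succ _ _
    have h6 : 0 < (s + 1 + n).choose s := Nat.choose_pos (by omega)
    exact_mod_cast (by omega :
      (s + 1 + n).choose (s + 1) < (s + 1 + (n + 1)).choose (s + 1))

lemma det_neg_aux (p : ℕ) (hp : 2 ≤ p) (c k : ℕ) (hk : k ≤ c + 1) :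
    Matrix.det !![rr p ((k : ℤ) - 1), rr p (k : ℤ);
                    rr p ((c : ℤ) - k + 1), rr p ((c : ℤ) - k)] < 0 := by
  rw [Matrix.det_fin_two_of]
  have h1 := rr_lt_aux p hp k
  have h2 := rr_lt_aux p hp (c + 1 - k)
  have e1 : ((c + 1 - k : ℕ) : ℤ) = (c : ℤ) - k + 1 := by omega
  have e2 : (c : ℤ) - k + 1 - 1 = (c : ℤ) - k := by ring
  rw [e1, e2] at h2
  have := mul_lt_mul'' h1 h2 (rr_nonneg_aux _ _) (rr_nonneg_aux _ _)
  linarith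

/-- the `2×2` determinants `det [[r_{k-1}, r_k], [r_{c-k+1}, r_{c-k}]]` are
negative for `0 ≤ k ≤ c+1`, and hence the products of two consecutive such determinants
are positive for `0 ≤ i ≤ c`. -/
theorem stmt4 (p : ℕ) (hp : 2 ≤ p) (c : ℕ) :
    (∀ k : ℕ, k ≤ c + 1 →
      Matrix.det !![rr p ((k : ℤ) - 1), rr p (k : ℤ);
                    rr p ((c : ℤ) - k + 1), rr p ((c : ℤ) - k)] < 0) ∧
    (∀ i : ℕ, i ≤ c →
      0 < Matrix.det !![rr p ((i : ℤ) - 1), rr p (i : ℤ);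
                        rr p ((c : ℤ) - i + 1), rr p ((c : ℤ) - i)] *
          Matrix.det !![rr p (i : ℤ), rr p ((i : ℤ) + 1);
                        rr p ((c : ℤ) - i), rr p ((c : ℤ) - i - 1)]) := by
  refine ⟨fun k hk => det_neg_aux p hp c k hk, fun i hi => ?_⟩
  have h1 := det_neg_aux p hp c i (by omega)
  have h2 := det_neg_aux p hp c (i + 1) (by omega)
  have e1 : ((i + 1 : ℕ) : ℤ) - 1 = (i : ℤ) := by push_cast; ring
  have e2 : (c : ℤ) - ((i + 1 : ℕ) : ℤ) + 1 = (c : ℤ) - i := by push_cast; ring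
  have e3 : (c : ℤ) - ((i + 1 : ℕ) : ℤ) = (c : ℤ) - i - 1 := by push_cast; ring
  have e4 : ((i + 1 : ℕ) : ℤ) = (i : ℤ) + 1 := by push_cast; ring
  rw [e1, e2, e3, e4] at h2
  exact mul_pos_of_neg_of_neg h1 h2
end

section
/- Let p ≥ 1 and j ≥ 0 be integers, set r_i = binomial(p-1+i, p-1) for i ≥ 0, and let h_j, h_{j+1}, h_{j+2} be rational numbers. Set a_j = h_j / r_j − h_{j+1} / r_{j+1} and a_{j+1} = h_{j+1} / r_{j+1} − h_{j+2} / r_{j+2}. Then a_{j+1} · (p·r_{j+1} − r_j) − a_j · r_j = (1 / r_{j+2}) · det [[h_j, h_{j+1}, h_{j+2}], [r_j, r_{j+1}, r_{j+2}], [p, 1, 0]] = −h_j + p·h_{j+1} − ((p·r_{j+1} − r_j) / r_{j+2}) · h_{j+2}. -/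
/-- the difference `D_{p-1,p+j} − D_{p,p+j} = a_{j+1}(p·r_{j+1} − r_j) − a_j·r_j`
equals `(1/r_{j+2})·det [[h_j,h_{j+1},h_{j+2}],[r_j,r_{j+1},r_{j+2}],[p,1,0]]`, which equals
`−h_j + p·h_{j+1} − ((p·r_{j+1} − r_j)/r_{j+2})·h_{j+2}`. -/
theorem stmt7 (p j : ℕ) (hp : 1 ≤ p) (h0 h1 h2 : ℚ)
    (r : ℕ → ℚ) (hr : ∀ i, r i = (Nat.choose (p - 1 + i) (p - 1) : ℚ))
    (a0 a1 : ℚ)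
    (ha0 : a0 = h0 / r j - h1 / r (j + 1))
    (ha1 : a1 = h1 / r (j + 1) - h2 / r (j + 2)) :
    a1 * ((p : ℚ) * r (j + 1) - r j) - a0 * r j =
        (1 / r (j + 2)) *
          Matrix.det !![h0, h1, h2; r j, r (j + 1), r (j + 2); (p : ℚ), 1, 0] ∧
      (1 / r (j + 2)) *
          Matrix.det !![h0, h1, h2; r j, r (j + 1), r (j + 2); (p : ℚ), 1, 0] =
        -h0 + (p : ℚ) * h1 - (((p : ℚ) * r (j + 1) - r j) / r (j + 2)) * h2 := by
  have hpos : ∀ i, r i ≠ 0 := by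
    intro i
    rw [hr i]
    exact_mod_cast (Nat.choose_pos (Nat.le_add_right _ _)).ne'
  have e0 := hpos j
  have e1 := hpos (j + 1)
  have e2 := hpos (j + 2)
  have hdet : Matrix.det !![h0, h1, h2; r j, r (j + 1), r (j + 2); (p : ℚ), 1, 0] =
      -h0 * r (j + 2) + p * h1 * r (j + 2) - (p * r (j + 1) - r j) * h2 := by
    simp [Matrix.det_fin_three]
    ring
  rw [hdet, ha0, ha1]
  generalize r j = x at *
  generalize r (j + 1) = y at *
  generalize r (j + 2) = z at *
  constructor
  · field_simp
    ring
  · field_simp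
end

section
/- Let D be a nonnegative linear combination of pure diagrams of codimension 3 such that row 0 of D has exactly one nonzero entry and row 3 of D has exactly one nonzero entry. Then for all integers k, l and every nonnegative rational b such that the function D − b·C^{k,l} has all entries nonnegative, the function D − b·C^{k,l} is again a nonnegative linear combination of pure diagrams of codimension 3. -/
def quad (s e f N : ℤ) (α β γ δ : ℚ) : ℤ × ℤ → ℚ :=
  Pi.single (0, s) α + Pi.single (1, e) β + Pi.single (2, f) γ + Pi.single (3, N) δ

theorem SPoly_quad (s e f N : ℤ) (α β γ δ : ℚ) : SPoly (quad s e f N α β γ δ) =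
    LaurentPolynomial.C α * LaurentPolynomial.T s - LaurentPolynomial.C β * LaurentPolynomial.T e
    + LaurentPolynomial.C γ * LaurentPolynomial.T f - LaurentPolynomial.C δ * LaurentPolynomial.T N := by
  unfold SPoly
  rw [finsum_eq_sum_of_support_subset (s := {(0, s), (1, e), (2, f), (3, N)})]
  · rw [Finset.sum_insert (by simp), Finset.sum_insert (by simp), Finset.sum_insert (by simp),
      Finset.sum_singleton]
    have h2 : ((-1 : ℚ) ^ (2 : ℤ)) = 1 := by norm_num
    have h3 : ((-1 : ℚ) ^ (3 : ℤ)) = -1 := by norm_num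
    simp [quad, h2, h3]
    ring
  · intro q hq
    by_contra hn
    apply hq
    simp at hn
    obtain ⟨h0, h1, h2, h3⟩ := hn
    simp [quad, h0, h1, h2, h3]

theorem T_mod (n : ℤ) : (1 - LaurentPolynomial.T 1 : LaurentPolynomial ℚ) ^ 3 ∣
    LaurentPolynomial.T n - (1 + LaurentPolynomial.C (n : ℚ) * (LaurentPolynomial.T 1 - 1)
      + LaurentPolynomial.C ((n : ℚ) * (n - 1) / 2) * (LaurentPolynomial.T 1 - 1) ^ 2) := by
  have key : ∀ n : ℤ, ∃ c : LaurentPolynomial ℚ, 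
     LaurentPolynomial.T 1 * (LaurentPolynomial.T n - (1 + LaurentPolynomial.C (n : ℚ) * (LaurentPolynomial.T 1 - 1)
      + LaurentPolynomial.C ((n : ℚ) * (n - 1) / 2) * (LaurentPolynomial.T 1 - 1) ^ 2))
     = LaurentPolynomial.T (n+1) - (1 + LaurentPolynomial.C ((n+1 : ℤ) : ℚ) * (LaurentPolynomial.T 1 - 1)
      + LaurentPolynomial.C (((n+1 : ℤ) : ℚ) * ((n+1 : ℤ) - 1) / 2) * (LaurentPolynomial.T 1 - 1) ^ 2)
      + (1 - LaurentPolynomial.T 1 : LaurentPolynomial ℚ) ^ 3 * c := by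
    intro n
    refine ⟨LaurentPolynomial.C ((n : ℚ) * (n - 1) / 2), ?_⟩
    have e : (((n+1 : ℤ) : ℚ) * ((n+1 : ℤ) - 1) / 2) = (n : ℚ) * (n - 1) / 2 + n := by
      push_cast; ring
    rw [e, LaurentPolynomial.T_add]
    push_cast
    simp only [map_add, map_one]
    ring
  induction n using Int.induction_on with
  | zero => simp
  | succ i ih =>
    obtain ⟨c, hc⟩ := key i
    have := ih.mul_left (LaurentPolynomial.T 1)
    rw [hc] at this
    exact (dvd_add_left (dvd_mul_right _ _)).1 this
  | pred i ih =>
    obtain ⟨c, hc⟩ := key (-i - 1)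
    rw [show (-(i:ℤ) - 1 + 1) = -i by ring] at hc
    have := dvd_add ih (dvd_mul_right _ c)
    rw [← hc] at this
    have h := this.mul_left (LaurentPolynomial.T (-1))
    rw [← mul_assoc, ← LaurentPolynomial.T_add] at h
    simpa using h

theorem dvd_of_moments (s e f N : ℤ) (α β γ δ : ℚ)
    (h0 : α - β + γ - δ = 0) (h1 : α * s - β * e + γ * f - δ * N = 0)
    (h2 : α * s ^ 2 - β * e ^ 2 + γ * f ^ 2 - δ * N ^ 2 = 0) :
    (1 - LaurentPolynomial.T 1) ^ 3 ∣ SPoly (quad s e f N α β γ δ) := by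
  rw [SPoly_quad]
  have H := dvd_sub (dvd_add (dvd_sub ((T_mod s).mul_left (LaurentPolynomial.C α))
    ((T_mod e).mul_left (LaurentPolynomial.C β))) ((T_mod f).mul_left (LaurentPolynomial.C γ)))
    ((T_mod N).mul_left (LaurentPolynomial.C δ))
  convert H using 1
  have e0 := congrArg (LaurentPolynomial.C (R := ℚ)) h0
  have e1 := congrArg (LaurentPolynomial.C (R := ℚ)) h1
  have e2 := congrArg (LaurentPolynomial.C (R := ℚ)) (show α * (s * (s - 1) / 2) - β * (e * (e - 1) / 2) 
     + γ * (f * (f - 1) / 2) - δ * (N * (N - 1) / 2) = 0 by linarith)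
  simp only [map_add, map_sub, map_mul, map_zero] at e0 e1 e2 ⊢
  generalize LaurentPolynomial.C ((s : ℚ) * (s - 1) / 2) = a1 at *
  generalize LaurentPolynomial.C ((e : ℚ) * (e - 1) / 2) = a2 at *
  generalize LaurentPolynomial.C ((f : ℚ) * (f - 1) / 2) = a3 at *
  generalize LaurentPolynomial.C ((N : ℚ) * (N - 1) / 2) = a4 at *
  linear_combination e0 + (LaurentPolynomial.T 1 - 1) * e1 + (LaurentPolynomial.T 1 - 1) ^ 2 * e2

/-- The functional sending `T j` to `g j`. -/
noncomputable def Lf (g : ℤ → ℚ) : LaurentPolynomial ℚ →+ ℚ where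
  toFun p := Finsupp.sum p.coeff (fun j c => c * g j)
  map_zero' := by simp
  map_add' p q := by
    simp [Finsupp.sum_add_index', add_mul]

theorem Lf_CT (g : ℤ → ℚ) (n : ℤ) (a : ℚ) :
    Lf g (LaurentPolynomial.C a * LaurentPolynomial.T n) = a * g n := by
  rw [← LaurentPolynomial.single_eq_C_mul_T]
  change Finsupp.sum (AddMonoidAlgebra.single n a : LaurentPolynomial ℚ).coeff (fun j c => c * g j) = _
  rw [AddMonoidAlgebra.coeff_single, Finsupp.sum_single_index (by simp)]

theorem Lf_diff (g : ℤ → ℚ) (p : LaurentPolynomial ℚ) :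
    Lf g ((1 - LaurentPolynomial.T 1) * p) = Lf (fun j => g j - g (j + 1)) p := by
  induction p using LaurentPolynomial.induction_on' with
  | add p q hp hq => rw [mul_add, map_add, map_add, hp, hq]
  | C_mul_T n a =>
    rw [show (1 - LaurentPolynomial.T 1) * (LaurentPolynomial.C a * LaurentPolynomial.T n)
      = LaurentPolynomial.C a * LaurentPolynomial.T n
        - LaurentPolynomial.C a * LaurentPolynomial.T (n + 1) by
        rw [LaurentPolynomial.T_add]; ring]
    rw [map_sub, Lf_CT, Lf_CT, Lf_CT]; ring

theorem moment_of_dvd (s e f N : ℤ) (α β γ δ : ℚ)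
    (h : (1 - LaurentPolynomial.T 1) ^ 3 ∣ SPoly (quad s e f N α β γ δ)) (u v : ℚ) :
    α * ((s - u) * (s - v)) - β * ((e - u) * (e - v)) + γ * ((f - u) * (f - v))
      - δ * ((N - u) * (N - v)) = 0 := by
  obtain ⟨c, hc⟩ := h
  have := congrArg (Lf (fun j => ((j : ℚ) - u) * (j - v))) hc
  rw [SPoly_quad, map_sub, map_add, map_sub, Lf_CT, Lf_CT, Lf_CT, Lf_CT, pow_succ, pow_succ, pow_one,
    mul_assoc, mul_assoc, Lf_diff, Lf_diff, Lf_diff] at this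
  rw [this]
  have : (fun j : ℤ => ((j : ℚ) - u) * (j - v)  - (((j + 1 : ℤ) : ℚ) - u) * ((j + 1 : ℤ) - v)
    - ((((j + 1 : ℤ) : ℚ) - u) * ((j + 1 : ℤ) - v) - (((j + 1 + 1: ℤ) : ℚ) - u) * ((j + 1 +1 : ℤ) - v))
    - (((((j + 1 : ℤ) : ℚ) - u) * ((j + 1 : ℤ) - v)  - (((j + 1 + 1 : ℤ) : ℚ) - u) * ((j + 1 + 1 : ℤ) - v)
    - ((((j + 1 + 1 : ℤ) : ℚ) - u) * ((j + 1 + 1 : ℤ) - v) - (((j + 1 + 1 + 1: ℤ) : ℚ) - u) * ((j + 1 +1 + 1 : ℤ) - v))))) = fun _ => 0 := by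
    funext j; push_cast; ring
  rw [this]
  simp [Lf]

theorem pure_eq_quad (d : Fin 4 → ℤ) (P : ℤ × ℤ → ℚ) (h : IsPureDiagram 3 d P) :
    P = quad (d 0) (d 1) (d 2) (d 3) (P (0, d 0)) (P (1, d 1)) (P (2, d 2)) (P (3, d 3)) := by
  funext ⟨i, j⟩
  have p0 := h.pure 0 j
  have p1 := h.pure 1 j
  have p2 := h.pure 2 j
  have p3 := h.pure 3 j
  by_cases hi : i < 0 ∨ (3 : ℤ) < i
  · rw [h.diagram.zero_outside i j (by exact_mod_cast hi)]
    have : i ≠ 0 ∧ i ≠ 1 ∧ i ≠ 2 ∧ i ≠ 3 := by omega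
    simp [quad, this]
  · have : i = 0 ∨ i = 1 ∨ i = 2 ∨ i = 3 := by omega
    simp at p0 p1 p2 p3
    rcases this with rfl | rfl | rfl | rfl <;> simp [quad, Pi.single_apply] <;>
    · split_ifs with hj
      · rw [hj]
      · first | exact p0 hj | exact p1 hj | exact p2 hj | exact p3 hj

/-- The normalised pure diagram. -/
def Pin (s e f N : ℤ) : ℤ × ℤ → ℚ :=
  quad s e f N (((f : ℚ) - e) / ((e - s) * (f - s) * (N - s))) (1 / (((e : ℚ) - s) * (N - e)))
    (1 / (((f : ℚ) - s) * (N - f))) (((f : ℚ) - e) / ((N - s) * (N - e) * (N - f)))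

theorem quad_nonneg (s e f N : ℤ) (α β γ δ : ℚ) (h0 : 0 ≤ α) (h1 : 0 ≤ β) (h2 : 0 ≤ γ) (h3 : 0 ≤ δ)
    (q : ℤ × ℤ) : 0 ≤ quad s e f N α β γ δ q := by
  simp only [quad, Pi.add_apply, Pi.single_apply]
  split_ifs <;> linarith

theorem Pin_nonneg (s e f N : ℤ) (h1 : s < e) (h2 : e < f) (h3 : f < N) (q : ℤ × ℤ) :
    0 ≤ Pin s e f N q := by
  have h1 : (s : ℚ) < e := by exact_mod_cast h1
  have h2 : (e : ℚ) < f := by exact_mod_cast h2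
  have h3 : (f : ℚ) < N := by exact_mod_cast h3
  have a1 : (0 : ℚ) ≤ e - s := by linarith
  have a2 : (0 : ℚ) ≤ f - s := by linarith
  have a3 : (0 : ℚ) ≤ N - s := by linarith
  have a4 : (0 : ℚ) ≤ f - e := by linarith
  have a5 : (0 : ℚ) ≤ N - e := by linarith
  have a6 : (0 : ℚ) ≤ N - f := by linarith
  apply quad_nonneg <;> positivity

theorem Pin_pure (s e f N : ℤ) (h1 : s < e) (h2 : e < f) (h3 : f < N) :
    IsPureDiagram 3 ![s, e, f, N] (Pin s e f N) where
  diagram := by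
    refine ⟨?_, ?_, ?_⟩
    · apply Set.Finite.subset (Finset.finite_toSet {((0:ℤ), s), (1, e), (2, f), (3, N)})
      intro q hq
      by_contra hn
      apply hq
      simp at hn
      obtain ⟨h0, h1, h2, h3⟩ := hn
      simp [Pin, quad, h0, h1, h2, h3]
    · intro i j hi
      have : i ≠ 0 ∧ i ≠ 1 ∧ i ≠ 2 ∧ i ≠ 3 := by push_cast at hi; omega
      simp [Pin, quad, this]
    · have h1 : (s : ℚ) < e := by exact_mod_cast h1
      have h2 : (e : ℚ) < f := by exact_mod_cast h2
      have h3 : (f : ℚ) < N := by exact_mod_cast h3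
      have a1 : (e - s : ℚ) ≠ 0 := by intro h; linarith
      have a2 : (f - s : ℚ) ≠ 0 := by intro h; linarith
      have a3 : (N - s : ℚ) ≠ 0 := by intro h; linarith
      have a5 : (N - e : ℚ) ≠ 0 := by intro h; linarith
      have a6 : (N - f : ℚ) ≠ 0 := by intro h; linarith
      apply dvd_of_moments <;> (field_simp; ring)
  strictMono := by
    rw [Fin.strictMono_iff_lt_succ]
    intro i
    fin_cases i <;> simpa
  pure := by
    intro k j hj
    fin_cases k <;> simp at hj <;> simp [Pin, quad, hj]

theorem pure_eq_smul (d : Fin 4 → ℤ) (P : ℤ × ℤ → ℚ) (h : IsPureDiagram 3 d P) 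
    (hP : ∀ q, 0 ≤ P q) :
    ∃ r : ℚ, 0 ≤ r ∧ P = r • Pin (d 0) (d 1) (d 2) (d 3) := by
  have hq := pure_eq_quad d P h
  have hd := h.diagram.dvd
  rw [hq] at hd
  have M := moment_of_dvd _ _ _ _ _ _ _ _ hd
  have h1 : (d 0 : ℚ) < d 1 := by exact_mod_cast h.strictMono (by decide)
  have h2 : (d 1 : ℚ) < d 2 := by exact_mod_cast h.strictMono (by decide)
  have h3 : (d 2 : ℚ) < d 3 := by exact_mod_cast h.strictMono (by decide)
  have a1 : (d 1 - d 0 : ℚ) ≠ 0 := by intro h; linarith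
  have a2 : (d 2 - d 0 : ℚ) ≠ 0 := by intro h; linarith
  have a3 : (d 3 - d 0 : ℚ) ≠ 0 := by intro h; linarith
  have a5 : (d 3 - d 1 : ℚ) ≠ 0 := by intro h; linarith
  have a6 : (d 3 - d 2 : ℚ) ≠ 0 := by intro h; linarith
  have hp1 := hP (1, d 1)
  refine ⟨P (1, d 1) * (d 1 - d 0) * (d 3 - d 1), mul_nonneg (mul_nonneg hp1 (by linarith)) (by linarith), ?_⟩
  have m1 := M (d 2) (d 3)
  have m2 := M (d 0) (d 3)
  have m3 := M (d 0) (d 2)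
  generalize P (0, d 0) = α at *
  generalize P (1, d 1) = β at *
  generalize P (2, d 2) = γ at *
  generalize P (3, d 3) = δ at *
  have sm : ∀ (r α β γ δ : ℚ) (s e f N : ℤ), r • quad s e f N α β γ δ =
      quad s e f N (r * α) (r * β) (r * γ) (r * δ) := by
    intro r α β γ δ s e f N
    simp only [quad, smul_add, ← Pi.single_smul, smul_eq_mul]
  rw [hq, Pin, sm]
  congr 1
  · field_simp; linear_combination m1
  · field_simp
  · field_simp; linear_combination -m2
  · field_simp; linear_combination -m3

theorem comb_zero : IsNonnegCombPure 3 0 :=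
  ⟨0, fun _ => 0, fun _ => 0, fun _ => 0, by simp, fun k => k.elim0, fun k => k.elim0, by simp⟩

theorem comb_add {D E : ℤ × ℤ → ℚ} (hD : IsNonnegCombPure 3 D) (hE : IsNonnegCombPure 3 E) :
    IsNonnegCombPure 3 (D + E) := by
  obtain ⟨n, a, P, t, h1, h2, h3, h4⟩ := hD
  obtain ⟨n', a', P', t', h1', h2', h3', h4'⟩ := hE
  refine ⟨n + n', Fin.append a a', Fin.append P P', Fin.append t t', ?_, ?_, ?_, ?_⟩
  · intro k; refine Fin.addCases (fun i => ?_) (fun i => ?_) k <;> simp [h1, h1']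
  · intro k; refine Fin.addCases (fun i => ?_) (fun i => ?_) k <;> simp [h2, h2']
  · intro k; refine Fin.addCases (fun i => ?_) (fun i => ?_) k <;> simp [h3, h3', -Prod.forall]
  · rw [Fin.sum_univ_add, h4, h4']; simp

theorem comb_sum {ι : Type*} (S : Finset ι) (F : ι → ℤ × ℤ → ℚ)
    (h : ∀ i ∈ S, IsNonnegCombPure 3 (F i)) : IsNonnegCombPure 3 (∑ i ∈ S, F i) :=
  Finset.sum_induction F _ (fun _ _ => comb_add) comb_zero h

theorem comb_Pin (r : ℚ) (hr : 0 ≤ r) (s e f N : ℤ) (h1 : s < e) (h2 : e < f) (h3 : f < N) :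
    IsNonnegCombPure 3 (r • Pin s e f N) :=
  ⟨1, fun _ => r, fun _ => Pin s e f N, fun _ => ![s, e, f, N], fun _ => hr,
    fun _ => Pin_pure s e f N h1 h2 h3, fun _ => Pin_nonneg s e f N h1 h2 h3, by simp⟩

theorem Pin_exchange (s e l f N : ℤ) (h1 : s < e) (h2 : e < l) (h3 : l < f) (h4 : f < N) :
    Pin s e l N + Pin s l f N = Pin s e f N + (1 / (((l : ℚ) - s) * (N - l))) • Ccan 1 l := by
  have h1 : (s : ℚ) < e := by exact_mod_cast h1
  have h2 : (e : ℚ) < l := by exact_mod_cast h2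
  have h3 : (l : ℚ) < f := by exact_mod_cast h3
  have h4 : (f : ℚ) < N := by exact_mod_cast h4
  have a1 : (e - s : ℚ) ≠ 0 := by intro h; linarith
  have a2 : (f - s : ℚ) ≠ 0 := by intro h; linarith
  have a3 : (N - s : ℚ) ≠ 0 := by intro h; linarith
  have a4 : (l - s : ℚ) ≠ 0 := by intro h; linarith
  have a5 : (N - e : ℚ) ≠ 0 := by intro h; linarith
  have a6 : (N - f : ℚ) ≠ 0 := by intro h; linarith
  have a7 : (N - l : ℚ) ≠ 0 := by intro h; linarith
  have hC : Ccan 1 l = Pi.single (1, l) 1 + Pi.single (2, l) 1 := by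
    funext q
    simp only [Ccan, Pi.add_apply, Pi.single_apply]
    by_cases h : q = (1, l)
    · subst h; simp
    · simp [h]
  have e1 : ((l : ℚ) - e) / ((e - s) * (l - s) * (N - s)) + ((f : ℚ) - l) / ((l - s) * (f - s) * (N - s))
     = ((f : ℚ) - e) / ((e - s) * (f - s) * (N - s)) := by field_simp; ring
  have e2 : ((l : ℚ) - e) / ((N - s) * (N - e) * (N - l)) + ((f : ℚ) - l) / ((N - s) * (N - l) * (N - f))
     = ((f : ℚ) - e) / ((N - s) * (N - e) * (N - f)) := by field_simp; ring
  rw [hC]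
  simp only [Pin, quad]
  rw [← e1, ← e2, Pi.single_add, Pi.single_add, smul_add, ← Pi.single_smul, ← Pi.single_smul, smul_eq_mul, mul_one]
  abel


theorem comb_smul {D : ℤ × ℤ → ℚ} (hD : IsNonnegCombPure 3 D) (r : ℚ) (hr : 0 ≤ r) :
    IsNonnegCombPure 3 (r • D) := by
  obtain ⟨n, a, P, t, h1, h2, h3, h4⟩ := hD
  refine ⟨n, fun k => r * a k, P, t, fun k => mul_nonneg hr (h1 k), h2, h3, ?_⟩
  rw [h4, Finset.smul_sum]
  simp only [mul_smul]

theorem Pin_ne (s e f N i j : ℤ) (h : Pin s e f N (i, j) ≠ 0) :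
    (i = 0 ∧ j = s) ∨ (i = 1 ∧ j = e) ∨ (i = 2 ∧ j = f) ∨ (i = 3 ∧ j = N) := by
  by_contra hn
  apply h
  have h0 : ¬ ((i, j) = (0, s)) := by simp only [Prod.mk.injEq]; tauto
  have h1 : ¬ ((i, j) = (1, e)) := by simp only [Prod.mk.injEq]; tauto
  have h2 : ¬ ((i, j) = (2, f)) := by simp only [Prod.mk.injEq]; tauto
  have h3 : ¬ ((i, j) = (3, N)) := by simp only [Prod.mk.injEq]; tauto
  simp only [Pin, quad, Pi.add_apply, Pi.single_apply, if_neg h0, if_neg h1, if_neg h2, if_neg h3]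
  norm_num

theorem Pin_one (s e f N j : ℤ) :
    Pin s e f N (1, j) = if e = j then 1 / (((j : ℚ) - s) * (N - j)) else 0 := by
  by_cases h : e = j
  · subst h; simp [Pin, quad]
  · simp [Pin, quad, h, Ne.symm h]

theorem Pin_two (s e f N j : ℤ) :
    Pin s e f N (2, j) = if f = j then 1 / (((j : ℚ) - s) * (N - j)) else 0 := by
  by_cases h : f = j
  · subst h; simp [Pin, quad]
  · simp [Pin, quad, h, Ne.symm h]

theorem Pin_zero_pos (s e f N : ℤ) (h1 : s < e) (h2 : e < f) (h3 : f < N) :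
    0 < Pin s e f N (0, s) := by
  have h1 : (s : ℚ) < e := by exact_mod_cast h1
  have h2 : (e : ℚ) < f := by exact_mod_cast h2
  have h3 : (f : ℚ) < N := by exact_mod_cast h3
  have a1 : (0 : ℚ) < e - s := by linarith
  have a2 : (0 : ℚ) < f - s := by linarith
  have a3 : (0 : ℚ) < N - s := by linarith
  have a4 : (0 : ℚ) < f - e := by linarith
  have : Pin s e f N (0, s) = (((f : ℚ) - e) / ((e - s) * (f - s) * (N - s))) := by
    simp [Pin, quad]
  rw [this]; positivity

theorem Pin_three_pos (s e f N : ℤ) (h1 : s < e) (h2 : e < f) (h3 : f < N) :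
    0 < Pin s e f N (3, N) := by
  have h1 : (s : ℚ) < e := by exact_mod_cast h1
  have h2 : (e : ℚ) < f := by exact_mod_cast h2
  have h3 : (f : ℚ) < N := by exact_mod_cast h3
  have a3 : (0 : ℚ) < N - s := by linarith
  have a4 : (0 : ℚ) < f - e := by linarith
  have a5 : (0 : ℚ) < N - e := by linarith
  have a6 : (0 : ℚ) < N - f := by linarith
  have : Pin s e f N (3, N) = (((f : ℚ) - e) / ((N - s) * (N - e) * (N - f))) := by
    simp [Pin, quad]
  rw [this]; positivity

/-- a nonnegative linear combination of pure diagrams of codimension `3`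
with a single nonzero entry in row `0` and in row `3` stays a nonnegative linear
combination of pure diagrams after any consecutive cancellation. -/
theorem stmt11 (D : ℤ × ℤ → ℚ) (hD : IsNonnegCombPure 3 D)
    (h0 : ∃! j : ℤ, D (0, j) ≠ 0) (h3 : ∃! j : ℤ, D (3, j) ≠ 0) :
    ∀ (k l : ℤ) (b : ℚ), 0 ≤ b → (∀ q, 0 ≤ D q - b * Ccan k l q) →
      IsNonnegCombPure 3 (fun q => D q - b * Ccan k l q) := by
  intro k l b hb hnn
  rcases hb.eq_or_lt with rfl | hb
  · simpa using hD
  obtain ⟨n, a, P, t, ha, hP, hPn, hDs⟩ := hD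
  obtain ⟨s, -, hs⟩ := h0
  obtain ⟨N, -, hN⟩ := h3
  choose r hr hPr using fun k => pure_eq_smul (t k) (P k) (hP k) (hPn k)
  have mono : ∀ i, t i 0 < t i 1 ∧ t i 1 < t i 2 ∧ t i 2 < t i 3 := fun i =>
    ⟨(hP i).strictMono (by decide), (hP i).strictMono (by decide), (hP i).strictMono (by decide)⟩
  set w : Fin n → ℚ := fun i => a i * r i with hw
  have hw0 : ∀ i, 0 ≤ w i := fun i => mul_nonneg (ha i) (hr i)
  set S : Finset (Fin n) := Finset.univ.filter (fun i => w i ≠ 0) with hS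
  have hD0 : D = ∑ i ∈ S, w i • Pin (t i 0) (t i 1) (t i 2) (t i 3) := by
    rw [hS, Finset.sum_filter_of_ne]
    · rw [hDs]
      refine Finset.sum_congr rfl fun i _ => ?_
      conv_lhs => rw [hPr i]
      rw [smul_smul]
    · intro i _ h h'
      exact h (by rw [h', zero_smul])
  have hwS : ∀ i ∈ S, 0 < w i := fun i hi =>
    lt_of_le_of_ne (hw0 i) (Ne.symm (by simpa [hS] using hi))
  clear_value S
  have hge : ∀ i ∈ S, ∀ q, w i * Pin (t i 0) (t i 1) (t i 2) (t i 3) q ≤ D q := by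
    intro i hi q
    rw [hD0, Finset.sum_apply]
    exact Finset.single_le_sum
      (f := fun i => (w i • Pin (t i 0) (t i 1) (t i 2) (t i 3)) q)
      (fun m _ => mul_nonneg (hw0 m) (Pin_nonneg _ _ _ _ (mono m).1 (mono m).2.1 (mono m).2.2 q)) hi
  have ht0 : ∀ i ∈ S, t i 0 = s := fun i hi => hs _ (ne_of_gt (lt_of_lt_of_le
    (mul_pos (hwS i hi) (Pin_zero_pos _ _ _ _ (mono i).1 (mono i).2.1 (mono i).2.2)) (hge i hi _)))
  have ht3 : ∀ i ∈ S, t i 3 = N := fun i hi => hN _ (ne_of_gt (lt_of_lt_of_le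
    (mul_pos (hwS i hi) (Pin_three_pos _ _ _ _ (mono i).1 (mono i).2.1 (mono i).2.2)) (hge i hi _)))
  have hD1 : D = ∑ i ∈ S, w i • Pin s (t i 1) (t i 2) N := by
    rw [hD0]
    refine Finset.sum_congr rfl fun i hi => ?_
    rw [ht0 i hi, ht3 i hi]
  have mono' : ∀ i ∈ S, s < t i 1 ∧ t i 1 < t i 2 ∧ t i 2 < N := by
    intro i hi
    have := mono i
    rwa [ht0 i hi, ht3 i hi] at this
  have hsupp : ∀ q, D q ≠ 0 → ∃ i ∈ S, Pin s (t i 1) (t i 2) N q ≠ 0 := by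
    intro q hq
    rw [hD1, Finset.sum_apply] at hq
    obtain ⟨i, hi, h⟩ := Finset.exists_ne_zero_of_sum_ne_zero hq
    exact ⟨i, hi, fun h' => h (by simp [h'])⟩
  have hb1 : b ≤ D (k, l) := by
    have := hnn (k, l)
    simp [Ccan] at this
    exact this
  have hb2 : b ≤ D (k + 1, l) := by
    have := hnn (k + 1, l)
    simp [Ccan] at this
    exact this
  obtain ⟨i1, hi1, hp1⟩ := hsupp _ (ne_of_gt (lt_of_lt_of_le hb hb1))
  obtain ⟨i2, hi2, hp2⟩ := hsupp _ (ne_of_gt (lt_of_lt_of_le hb hb2))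
  have q1 := Pin_ne _ _ _ _ _ _ hp1
  have q2 := Pin_ne _ _ _ _ _ _ hp2
  have m1 := mono' i1 hi1
  have m2 := mono' i2 hi2
  obtain ⟨rfl, hl1, hl2⟩ : k = 1 ∧ s < l ∧ l < N := by omega
  have g1 : (0 : ℚ) < l - s := by rw [sub_pos]; exact_mod_cast hl1
  have g2 : (0 : ℚ) < N - l := by rw [sub_pos]; exact_mod_cast hl2
  clear hp1 hp2 q1 q2 m1 m2 hi1 hi2 i1 i2
  set u : ℚ := 1 / (((l : ℚ) - s) * (N - l)) with hu
  have hu0 : 0 < u := by positivity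
  set K1 := S.filter (fun i => t i 1 = l) with hK1
  set S' := S.filter (fun i => ¬ t i 1 = l) with hS'
  set K2 := S'.filter (fun i => t i 2 = l) with hK2
  set K3 := S'.filter (fun i => ¬ t i 2 = l) with hK3
  have hK2' : K2 = S.filter (fun i => t i 2 = l) := by
    ext i
    simp only [hK2, hS', Finset.mem_filter]
    constructor
    · rintro ⟨⟨h1, h2⟩, h3⟩; exact ⟨h1, h3⟩
    · rintro ⟨h1, h3⟩
      have := mono' i h1
      exact ⟨⟨h1, by omega⟩, h3⟩
  set X := ∑ i ∈ K1, w i with hX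
  set Y := ∑ i ∈ K2, w i with hY
  have hXD : D (1, l) = X * u := by
    rw [hD1, Finset.sum_apply, hX, hK1, Finset.sum_filter, Finset.sum_mul]
    refine Finset.sum_congr rfl fun i _ => ?_
    rw [Pi.smul_apply, Pin_one, smul_eq_mul]
    split_ifs <;> simp [hu]
  have hYD : D (1 + 1, l) = Y * u := by
    rw [hD1, Finset.sum_apply, hY, hK2', Finset.sum_filter, Finset.sum_mul]
    refine Finset.sum_congr rfl fun i _ => ?_
    rw [Pi.smul_apply, show (1 + 1 : ℤ) = 2 by norm_num, Pin_two, smul_eq_mul]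
    split_ifs <;> simp [hu]
  rw [hXD] at hb1
  rw [hYD] at hb2
  have hX0 : 0 < X := by
    by_contra h
    nlinarith
  have hY0 : 0 < Y := by
    by_contra h
    nlinarith
  set c := b / u with hc
  have hc0 : 0 < c := by positivity
  have hcX : c ≤ X := by rw [hc, div_le_iff₀ hu0]; exact hb1
  have hcY : c ≤ Y := by rw [hc, div_le_iff₀ hu0]; exact hb2
  set A := ∑ i ∈ K1, w i • Pin s (t i 1) (t i 2) N with hA
  set B := ∑ i ∈ K2, w i • Pin s (t i 1) (t i 2) N with hB
  set R := ∑ i ∈ K3, w i • Pin s (t i 1) (t i 2) N with hR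
  set Z := ∑ i ∈ K2, ∑ m ∈ K1, (w i * w m) • Pin s (t i 1) (t m 2) N with hZ
  have hsplit : D = A + (B + R) := by
    rw [hD1, hA, hB, hR, hK2, hK3, Finset.sum_filter_add_sum_filter_not, hK1, hS',
      Finset.sum_filter_add_sum_filter_not]
  have K1S : ∀ i ∈ K1, i ∈ S ∧ t i 1 = l := by intro i hi; simpa [hK1] using hi
  have K2S : ∀ i ∈ K2, i ∈ S ∧ t i 2 = l := by intro i hi; rw [hK2'] at hi; simpa using hi
  have K3S : ∀ i ∈ K3, i ∈ S := by intro i hi; simp [hK3, hS'] at hi; exact hi.1.1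
  have hcomb : ∀ K : Finset (Fin n), (∀ i ∈ K, i ∈ S) →
      IsNonnegCombPure 3 (∑ i ∈ K, w i • Pin s (t i 1) (t i 2) N) := by
    intro K hK
    refine comb_sum _ _ fun i hi => ?_
    have := mono' i (hK i hi)
    exact comb_Pin _ (hw0 i) _ _ _ _ this.1 this.2.1 this.2.2
  have hZc : IsNonnegCombPure 3 Z := by
    refine comb_sum _ _ fun i hi => comb_sum _ _ fun m hm => ?_
    obtain ⟨p1, p2⟩ := K2S i hi
    obtain ⟨p3, p4⟩ := K1S m hm
    have q1 := mono' i p1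
    have q2 := mono' m p3
    exact comb_Pin _ (mul_nonneg (hw0 i) (hw0 m)) _ _ _ _ (by omega) (by omega) (by omega)
  have hex : X • B + Y • A = Z + (X * Y * u) • Ccan 1 l := by
    have l1 : X • B = ∑ i ∈ K2, ∑ m ∈ K1, (w i * w m) • Pin s (t i 1) (t i 2) N := by
      rw [hB, Finset.smul_sum]
      refine Finset.sum_congr rfl fun i _ => ?_
      rw [← Finset.sum_smul, ← Finset.mul_sum, smul_smul, mul_comm]
    have l2 : Y • A = ∑ i ∈ K2, ∑ m ∈ K1, (w i * w m) • Pin s (t m 1) (t m 2) N := by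
      rw [hY, Finset.sum_smul]
      refine Finset.sum_congr rfl fun i _ => ?_
      rw [hA, Finset.smul_sum]
      refine Finset.sum_congr rfl fun m _ => ?_
      rw [smul_smul]
    have l3 : (X * Y * u) • Ccan 1 l = ∑ i ∈ K2, ∑ m ∈ K1, (w i * w m) • (u • Ccan 1 l) := by
      simp only [← Finset.sum_smul, ← Finset.mul_sum, ← Finset.sum_mul]
      rw [smul_smul]
      congr 1
      ring
    rw [l1, l2, l3, hZ, ← Finset.sum_add_distrib, ← Finset.sum_add_distrib]
    refine Finset.sum_congr rfl fun i hi => ?_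
    rw [← Finset.sum_add_distrib, ← Finset.sum_add_distrib]
    refine Finset.sum_congr rfl fun m hm => ?_
    obtain ⟨p1, p2⟩ := K2S i hi
    obtain ⟨p3, p4⟩ := K1S m hm
    have q1 := mono' i p1
    have q2 := mono' m p3
    rw [← smul_add, ← smul_add, p2, p4, Pin_exchange s (t i 1) l (t m 2) N (by omega) (by omega)
      (by omega) (by omega)]
  have hfin : (fun q => D q - b * Ccan 1 l q) =
      R + ((1 - c / X) • A + ((1 - c / Y) • B + (c / (X * Y)) • Z)) := by
    funext q
    have e1 := congrFun hsplit q
    have e2 := congrFun hex q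
    simp only [Pi.add_apply, Pi.smul_apply, smul_eq_mul] at e1 e2 ⊢
    have hbc : b = c * u := by rw [hc]; field_simp
    have e3 : Z q = X * B q + Y * A q - X * Y * u * Ccan 1 l q := by linarith
    rw [e1, e3, hbc]
    field_simp
    ring
  rw [hfin]
  refine comb_add (hcomb _ K3S) (comb_add (comb_smul (hcomb _ fun i hi => (K1S i hi).1) _ ?_)
    (comb_add (comb_smul (hcomb _ fun i hi => (K2S i hi).1) _ ?_) (comb_smul hZc _ ?_)))
  · rw [sub_nonneg, div_le_one hX0]; exact hcX
  · rw [sub_nonneg, div_le_one hY0]; exact hcY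
  · positivity
end

section
/- Let D be a diagram of codimension 1, i.e. a function D : ℤ × ℤ → ℚ with finitely many nonzero values, D i j = 0 unless i ∈ {0,1}, and Σ_{i,j} (-1)^i (D i j) t^j divisible by (1−t) in ℚ[t,t⁻¹]. Then D is a nonnegative linear combination of pure diagrams of codimension 1 if and only if all entries of D are nonnegative and for every integer l one has Σ_{i ≤ l} D 0 i ≥ Σ_{i ≤ l} D 1 (i+1). -/
open LaurentPolynomial in
/-- Evaluation at `1`. -/
noncomputable def evOne : LaurentPolynomial ℚ →+* ℚ :=
  LaurentPolynomial.eval₂ (RingHom.id ℚ) (1 : ℚˣ)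

lemma evOne_CT (c : ℚ) (n : ℤ) :
    evOne (LaurentPolynomial.C c * LaurentPolynomial.T n) = c := by
  simp [evOne]

lemma SPoly_eq_s12 (D : ℤ × ℤ → ℚ) (s : Finset ℤ) (h0 : ∀ i j : ℤ, i < 0 ∨ 1 < i → D (i, j) = 0)
    (hs : ∀ i j : ℤ, j ∉ s → D (i, j) = 0) :
    SPoly D = ∑ j ∈ s, LaurentPolynomial.C (D (0, j)) * LaurentPolynomial.T j
      - ∑ j ∈ s, LaurentPolynomial.C (D (1, j)) * LaurentPolynomial.T j := by
  unfold SPoly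
  rw [finsum_eq_sum_of_support_subset (s := ({0, 1} : Finset ℤ) ×ˢ s)]
  · rw [Finset.sum_product, Finset.sum_pair (by norm_num)]
    simp [sub_eq_add_neg]
  · rintro ⟨i, j⟩ hq
    have hne : D (i, j) ≠ 0 := by
      intro h
      apply hq
      simp [h]
    have hj : j ∈ s := by
      by_contra hj
      exact hne (hs i j hj)
    have hi : ¬ (i < 0 ∨ 1 < i) := fun hi => hne (h0 i j hi)
    have : i = 0 ∨ i = 1 := by omega
    simp [hj, this]

lemma diag_sum (D : ℤ × ℤ → ℚ) (hD : IsDiagram 1 D) (s : Finset ℤ)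
    (hs : ∀ i j : ℤ, j ∉ s → D (i, j) = 0) :
    ∑ j ∈ s, D (0, j) = ∑ j ∈ s, D (1, j) := by
  have h0 : ∀ i j : ℤ, i < 0 ∨ 1 < i → D (i, j) = 0 := fun i j h =>
    hD.zero_outside i j (by simpa using h)
  obtain ⟨r, hr⟩ := hD.dvd
  have h1 : evOne (SPoly D) = 0 := by
    rw [hr, map_mul]
    have : evOne ((1 - LaurentPolynomial.T 1) ^ 1) = 0 := by simp [evOne]
    rw [this, zero_mul]
  rw [SPoly_eq_s12 D s h0 hs, map_sub, map_sum, map_sum] at h1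
  simp only [evOne_CT] at h1
  linarith

lemma exists_box (D : ℤ × ℤ → ℚ) (h : (Function.support D).Finite) :
    ∃ s : Finset ℤ, ∀ i j : ℤ, j ∉ s → D (i, j) = 0 := by
  classical
  refine ⟨h.toFinset.image Prod.snd, fun i j hj => ?_⟩
  by_contra hne
  apply hj
  rw [Finset.mem_image]
  exact ⟨(i, j), by simpa using hne, rfl⟩

/-- The diagram with the two rows `x`, `y`. -/
def mkD (x y : ℤ → ℚ) : ℤ × ℤ → ℚ :=
  fun q => if q.1 = 0 then x q.2 else if q.1 = 1 then y q.2 else 0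

lemma pure_mk (a b : ℤ) (hab : a < b) :
    IsPureDiagram 1 ![a, b] (mkD (fun i => if i = a then 1 else 0) (fun i => if i = b then 1 else 0)) := by
  have h0 : ∀ i j : ℤ, i < 0 ∨ 1 < i →
      mkD (fun i => if i = a then 1 else 0) (fun i => if i = b then 1 else 0) (i, j) = 0 := by
    intro i j h
    have h1 : i ≠ 0 := by omega
    have h2 : i ≠ 1 := by omega
    simp [mkD, h1, h2]
  refine ⟨⟨?_, ?_, ?_⟩, ?_, ?_⟩
  · apply Set.Finite.subset (Set.toFinite ({(0, a), (1, b)} : Set (ℤ × ℤ)))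
    rintro ⟨i, j⟩ h
    simp only [mkD, Function.mem_support] at h
    simp only [Set.mem_insert_iff, Set.mem_singleton_iff, Prod.mk.injEq]
    grind
  · intro i j h
    exact h0 i j (by simpa using h)
  · rw [SPoly_eq_s12 _ {a, b} h0]
    · rw [Finset.sum_pair hab.ne, Finset.sum_pair hab.ne]
      obtain ⟨n, hn⟩ := Int.le.dest hab.le
      have hT : (LaurentPolynomial.T b : LaurentPolynomial ℚ)
          = LaurentPolynomial.T a * LaurentPolynomial.T 1 ^ n := by
        rw [← hn, LaurentPolynomial.T_add, LaurentPolynomial.T_pow]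
        rw [mul_one]
      simp [mkD, hab.ne, hab.ne']
      rw [hT]
      have := (one_sub_dvd_one_sub_pow (LaurentPolynomial.T 1 : LaurentPolynomial ℚ) n).mul_left
        (LaurentPolynomial.T a)
      rwa [mul_sub, mul_one] at this
    · intro i j hj
      simp at hj
      simp [mkD, hj]
  · intro i j hij
    fin_cases i <;> fin_cases j <;> simp_all
  · intro k j hj
    fin_cases k <;> simp_all [mkD]

lemma comb_add_s12 (D P : ℤ × ℤ → ℚ) (c : ℚ) (t : Fin 2 → ℤ) (hc : 0 ≤ c) (hP : IsPureDiagram 1 t P)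
    (hP0 : ∀ q, 0 ≤ P q) (hD : IsNonnegCombPure 1 D) : IsNonnegCombPure 1 (c • P + D) := by
  obtain ⟨n, a, Q, u, h1, h2, h3, h4⟩ := hD
  refine ⟨n + 1, Fin.cons c a, Fin.cons P Q, Fin.cons t u, ?_, ?_, ?_, ?_⟩
  · intro k
    refine Fin.cases ?_ ?_ k <;> simp [hc, h1]
  · intro k
    refine Fin.cases ?_ ?_ k
    · simpa using hP
    · simpa using h2
  · intro k
    refine Fin.cases ?_ ?_ k
    · simpa using hP0
    · simpa using h3
  · rw [Fin.sum_univ_succ]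
    simp [h4]

lemma core (s : Finset ℤ) : ∀ (n : ℕ) (x y : ℤ → ℚ),
    (s.filter (fun i => x i ≠ 0)).card + (s.filter (fun i => y i ≠ 0)).card ≤ n →
    (∀ i, i ∉ s → x i = 0) → (∀ i, i ∉ s → y i = 0) → (∀ i, 0 ≤ x i) → (∀ i, 0 ≤ y i) →
    ∑ i ∈ s, x i = ∑ i ∈ s, y i →
    (∀ l : ℤ, (∑ i ∈ s, if i ≤ l + 1 then y i else 0) ≤ ∑ i ∈ s, if i ≤ l then x i else 0) →
    IsNonnegCombPure 1 (mkD x y) := by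
  intro n
  induction n with
  | zero =>
    intro x y hn hx hy _ _ _ _
    have h1 : (s.filter (fun i => x i ≠ 0)).card = 0 := by omega
    have h2 : (s.filter (fun i => y i ≠ 0)).card = 0 := by omega
    rw [Finset.card_eq_zero, Finset.filter_eq_empty_iff] at h1 h2
    refine ⟨0, Fin.elim0, Fin.elim0, Fin.elim0, fun k => k.elim0, fun k => k.elim0,
      fun k => k.elim0, ?_⟩
    have hx0 : x = fun _ => 0 := by
      funext i
      by_cases hi : i ∈ s
      · simpa using h1 hi
      · exact hx i hi
    have hy0 : y = fun _ => 0 := by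
      funext i
      by_cases hi : i ∈ s
      · simpa using h2 hi
      · exact hy i hi
    funext q
    simp [mkD, hx0, hy0]
  | succ n ih =>
    intro x y hn hx hy hx0 hy0 hsum hle
    by_cases hyz : (s.filter (fun i => y i ≠ 0)) = ∅
    · apply ih x y _ hx hy hx0 hy0 hsum hle
      rw [Finset.filter_eq_empty_iff] at hyz
      have : ∑ i ∈ s, y i = 0 := Finset.sum_eq_zero (fun i hi => by simpa using hyz hi)
      rw [this, Finset.sum_eq_zero_iff_of_nonneg (fun i _ => hx0 i)] at hsum
      have e1 : s.filter (fun i => x i ≠ 0) = ∅ := by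
        rw [Finset.filter_eq_empty_iff]
        intro i hi
        simpa using hsum i hi
      have e2 : s.filter (fun i => y i ≠ 0) = ∅ := by
        rw [Finset.filter_eq_empty_iff]; exact hyz
      rw [e1, e2]; simp
    · obtain ⟨b, hb, hbmin⟩ := Finset.exists_min_image _ id (Finset.nonempty_iff_ne_empty.2 hyz)
      rw [Finset.mem_filter] at hb
      have hypos : 0 < y b := lt_of_le_of_ne (hy0 b) (Ne.symm hb.2)
      have hpos : 0 < ∑ i ∈ s, if i ≤ b - 1 then x i else 0 := by
        refine lt_of_lt_of_le ?_ (hle (b - 1))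
        refine lt_of_lt_of_le hypos ?_
        have := Finset.single_le_sum (f := fun i => if i ≤ b - 1 + 1 then y i else 0) (s := s)
          (fun i _ => by split_ifs <;> simp [hy0]) hb.1
        simpa using this
      obtain ⟨a', ha's, ha'⟩ := Finset.exists_ne_zero_of_sum_ne_zero hpos.ne'
      have ha'b : a' ≤ b - 1 := by by_contra h; simp [h] at ha'
      rw [if_pos ha'b] at ha'
      obtain ⟨a, ha, hamin⟩ := Finset.exists_min_image (s.filter (fun i => x i ≠ 0)) id
        ⟨a', Finset.mem_filter.2 ⟨ha's, ha'⟩⟩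
      have hab : a < b := by
        have := hamin a' (Finset.mem_filter.2 ⟨ha's, ha'⟩)
        simp at this
        omega
      rw [Finset.mem_filter] at ha
      have hxpos : 0 < x a := lt_of_le_of_ne (hx0 a) (Ne.symm ha.2)
      set m := min (x a) (y b) with hm
      have hm0 : 0 ≤ m := le_min (hx0 a) (hy0 b)
      have hmx : m ≤ x a := min_le_left _ _
      have hmy : m ≤ y b := min_le_right _ _
      set x' : ℤ → ℚ := fun i => x i - if i = a then m else 0 with hx'
      set y' : ℤ → ℚ := fun i => y i - if i = b then m else 0 with hy'
      have key : mkD x y = m • mkD (fun i => if i = a then 1 else 0) (fun i => if i = b then 1 else 0)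
          + mkD x' y' := by
        funext q
        simp only [mkD, hx', hy', Pi.add_apply, Pi.smul_apply, smul_eq_mul]
        split_ifs <;> ring
      rw [key]
      refine comb_add_s12 _ _ m _ hm0 (pure_mk a b hab) ?_ (ih x' y' ?_ ?_ ?_ ?_ ?_ ?_ ?_)
      · intro q
        simp only [mkD]
        split_ifs <;> norm_num
      · have s1 : s.filter (fun i => x' i ≠ 0) ⊆ s.filter (fun i => x i ≠ 0) := by
          intro i hi
          rw [Finset.mem_filter] at hi ⊢
          refine ⟨hi.1, fun h => hi.2 ?_⟩
          have : i ≠ a := by rintro rfl; exact ha.2 h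
          simp [hx', h, this]
        have s2 : s.filter (fun i => y' i ≠ 0) ⊆ s.filter (fun i => y i ≠ 0) := by
          intro i hi
          rw [Finset.mem_filter] at hi ⊢
          refine ⟨hi.1, fun h => hi.2 ?_⟩
          have : i ≠ b := by rintro rfl; exact hb.2 h
          simp [hy', h, this]
        rcases min_choice (x a) (y b) with h | h
        · have : (s.filter (fun i => x' i ≠ 0)).card < (s.filter (fun i => x i ≠ 0)).card := by
            refine Finset.card_lt_card ((Finset.ssubset_iff_of_subset s1).2
              ⟨a, Finset.mem_filter.2 ha, fun h' => (Finset.mem_filter.1 h').2 ?_⟩)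
            simp [hx', hm, h]
          have := Finset.card_le_card s2
          omega
        · have : (s.filter (fun i => y' i ≠ 0)).card < (s.filter (fun i => y i ≠ 0)).card := by
            refine Finset.card_lt_card ((Finset.ssubset_iff_of_subset s2).2
              ⟨b, Finset.mem_filter.2 hb, fun h' => (Finset.mem_filter.1 h').2 ?_⟩)
            simp [hy', hm, h]
          have := Finset.card_le_card s1
          omega
      · intro i hi
        have : i ≠ a := by rintro rfl; exact hi ha.1
        simp [hx', hx i hi, this]
      · intro i hi
        have : i ≠ b := by rintro rfl; exact hi hb.1
        simp [hy', hy i hi, this]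
      · intro i
        simp only [hx']
        split_ifs with h
        · subst h; linarith
        · simpa using hx0 i
      · intro i
        simp only [hy']
        split_ifs with h
        · subst h; linarith
        · simpa using hy0 i
      · simp only [hx', hy', Finset.sum_sub_distrib, hsum]
        rw [Finset.sum_ite_eq' s a, Finset.sum_ite_eq' s b, if_pos ha.1, if_pos hb.1]
      · intro l
        have ex : (∑ i ∈ s, if i ≤ l then x' i else 0)
            = (∑ i ∈ s, if i ≤ l then x i else 0) - if a ≤ l then m else 0 := by
          have : ∀ i ∈ s, (if i ≤ l then x' i else 0)
              = (if i ≤ l then x i else 0) - if i = a then (if a ≤ l then m else 0) else 0 := by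
            intro i _
            simp only [hx']
            grind
          rw [Finset.sum_congr rfl this, Finset.sum_sub_distrib, Finset.sum_ite_eq' s a,
            if_pos ha.1]
        have ey : (∑ i ∈ s, if i ≤ l + 1 then y' i else 0)
            = (∑ i ∈ s, if i ≤ l + 1 then y i else 0) - if b ≤ l + 1 then m else 0 := by
          have : ∀ i ∈ s, (if i ≤ l + 1 then y' i else 0)
              = (if i ≤ l + 1 then y i else 0)
                - if i = b then (if b ≤ l + 1 then m else 0) else 0 := by
            intro i _
            simp only [hy']
            grind
          rw [Finset.sum_congr rfl this, Finset.sum_sub_distrib, Finset.sum_ite_eq' s b,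
            if_pos hb.1]
        by_cases hbl : b ≤ l + 1
        · rw [ex, ey, if_pos hbl, if_pos (by omega)]
          linarith [hle l]
        · have : (∑ i ∈ s, if i ≤ l + 1 then y' i else 0) = 0 := by
            apply Finset.sum_eq_zero
            intro i hi
            split_ifs with h
            · have hib : i ≠ b := by omega
              simp only [hy', if_neg hib, sub_zero]
              by_contra hne
              have := hbmin i (Finset.mem_filter.2 ⟨hi, hne⟩)
              simp at this
              omega
            · rfl
          rw [this]
          apply Finset.sum_nonneg
          intro i _
          simp only [hx']
          split_ifs with h1 h2
          · subst h2; linarith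
          · simpa using hx0 i
          · exact le_refl _

lemma fin0 (D : ℤ × ℤ → ℚ) (s : Finset ℤ) (hs : ∀ i j : ℤ, j ∉ s → D (i, j) = 0) (l : ℤ) :
    (∑ᶠ i : ℤ, if i ≤ l then D (0, i) else 0) = ∑ i ∈ s, if i ≤ l then D (0, i) else 0 := by
  apply finsum_eq_sum_of_support_subset
  intro i hi
  by_contra h
  apply hi
  simp [hs 0 i h]

lemma fin1 (D : ℤ × ℤ → ℚ) (s : Finset ℤ) (hs : ∀ i j : ℤ, j ∉ s → D (i, j) = 0) (l : ℤ) :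
    (∑ᶠ i : ℤ, if i ≤ l then D (1, i + 1) else 0)
      = ∑ i ∈ s, if i ≤ l + 1 then D (1, i) else 0 := by
  have := finsum_comp_equiv (Equiv.addRight (1 : ℤ)) (f := fun i => if i ≤ l + 1 then D (1, i) else 0)
  simp only [Equiv.coe_addRight, add_le_add_iff_right] at this
  rw [this]
  apply finsum_eq_sum_of_support_subset
  intro i hi
  by_contra h
  apply hi
  simp [hs 1 i h]

lemma pure_ineq (P : ℤ × ℤ → ℚ) (t : Fin 2 → ℤ) (hP : IsPureDiagram 1 t P) (hP0 : ∀ q, 0 ≤ P q)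
    (s : Finset ℤ) (hs : ∀ i j : ℤ, j ∉ s → P (i, j) = 0) (l : ℤ) :
    (∑ i ∈ s, if i ≤ l + 1 then P (1, i) else 0) ≤ ∑ i ∈ s, if i ≤ l then P (0, i) else 0 := by
  have h := diag_sum P hP.diagram s hs
  have hlt : t 0 < t 1 := hP.strictMono (by simp)
  have p0 : ∀ j, j ≠ t 0 → P (0, j) = 0 := fun j hj => by simpa using hP.pure 0 j hj
  have p1 : ∀ j, j ≠ t 1 → P (1, j) = 0 := fun j hj => by simpa using hP.pure 1 j hj
  by_cases hl : t 1 ≤ l + 1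
  · calc _ ≤ ∑ i ∈ s, P (1, i) := by
          apply Finset.sum_le_sum
          intro i _
          split_ifs
          · exact le_refl _
          · exact hP0 _
      _ = ∑ i ∈ s, P (0, i) := h.symm
      _ = _ := by
          apply Finset.sum_congr rfl
          intro i _
          split_ifs with hi
          · rfl
          · exact p0 i (by omega)
  · rw [Finset.sum_eq_zero]
    · apply Finset.sum_nonneg
      intro i _
      split_ifs
      · exact hP0 _
      · exact le_refl _
    · intro i _
      split_ifs with hi
      · exact p1 i (by omega)
      · rfl

theorem stmt12 (D : ℤ × ℤ → ℚ) (hD : IsDiagram 1 D) :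
    IsNonnegCombPure 1 D ↔
      ((∀ q, 0 ≤ D q) ∧ ∀ l : ℤ,
        (∑ᶠ i : ℤ, if i ≤ l then D (1, i + 1) else 0) ≤
          ∑ᶠ i : ℤ, if i ≤ l then D (0, i) else 0) := by
  constructor
  · rintro ⟨n, a, P, t, ha, hP, hP0, rfl⟩
    have happ : ∀ q, (∑ k, a k • P k) q = ∑ k, a k * P k q := by
      intro q
      simp [Finset.sum_apply]
    constructor
    · intro q
      rw [happ]
      exact Finset.sum_nonneg fun k _ => mul_nonneg (ha k) (hP0 k q)
    · intro l
      choose S hS using fun k => exists_box (P k) (hP k).diagram.finite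
      have hs : ∀ k i j, j ∉ Finset.univ.biUnion S → P k (i, j) = 0 := by
        intro k i j hj
        apply hS k i j
        intro h
        exact hj (Finset.mem_biUnion.2 ⟨k, Finset.mem_univ _, h⟩)
      have hs' : ∀ i j, j ∉ Finset.univ.biUnion S → (∑ k, a k • P k) (i, j) = 0 := by
        intro i j hj
        rw [happ]
        exact Finset.sum_eq_zero fun k _ => by rw [hs k i j hj, mul_zero]
      rw [fin0 _ _ hs', fin1 _ _ hs']
      have e : ∀ (r m : ℤ), (∑ i ∈ Finset.univ.biUnion S,
          if i ≤ m then (∑ k, a k • P k) (r, i) else 0)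
          = ∑ k, a k * ∑ i ∈ Finset.univ.biUnion S, if i ≤ m then P k (r, i) else 0 := by
        intro r m
        simp only [Finset.mul_sum]
        rw [Finset.sum_comm]
        apply Finset.sum_congr rfl
        intro i _
        rw [happ]
        split_ifs <;> simp
      rw [e, e]
      exact Finset.sum_le_sum fun k _ => mul_le_mul_of_nonneg_left
        (pure_ineq (P k) (t k) (hP k) (hP0 k) _ (hs k) l) (ha k)
  · rintro ⟨h0, hle⟩
    obtain ⟨s, hs⟩ := exists_box D hD.finite
    have hDe : D = mkD (fun i => D (0, i)) (fun i => D (1, i)) := by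
      funext ⟨i, j⟩
      simp only [mkD]
      split_ifs with h1 h2
      · rw [h1]
      · rw [h2]
      · exact hD.zero_outside i j (by push_cast; omega)
    rw [hDe]
    refine core s _ _ _ le_rfl (hs 0) (hs 1) (fun i => h0 _) (fun i => h0 _)
      (diag_sum D hD s hs) ?_
    intro l
    rw [← fin0 D s hs, ← fin1 D s hs]
    exact hle l
end
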